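/- arXiv:1609.08481 — 2 statements merged into one kernel-verified Lean document; each statement's English description precedes it below -/
import Mathlib

section
/- For every x ∈ ℒ_n, every ε > 0 and every k ∈ {1,…,n}, there exists a ∈ A such that α_k(a·x) ≥ 1 − ε. -/
open scoped BigOperators
open Matrix Topology Filter

noncomputable section

namespace SW

/-! ### Euclidean structure on `Fin n → ℝ` -/

/-- The standard Euclidean inner product on `Fin n → ℝ`. -/
def einner {n : ℕ} (v w : Fin n → ℝ) : ℝ := ∑ i, v i * w i

/-- The Euclidean norm on `Fin n → ℝ`. -/
def enorm {n : ℕ} (v : Fin n → ℝ) : ℝ := Real.sqrt (∑ i, v i ^ 2)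

lemma einner_add_left {n : ℕ} (u v w : Fin n → ℝ) :
    einner (u + v) w = einner u w + einner v w := by
  simp [einner, add_mul, Finset.sum_add_distrib]

lemma einner_neg_left {n : ℕ} (u w : Fin n → ℝ) : einner (-u) w = -einner u w := by
  simp [einner]

lemma einner_smul_left {n : ℕ} (c : ℝ) (u w : Fin n → ℝ) :
    einner (c • u) w = c * einner u w := by
  simp [einner, Finset.mul_sum, mul_assoc]

/-! ### Covolume, rank, lattices, stability -/

/-- `√(det Gram)` of a finite family of vectors: the covolume of the ℤ-span of the family
(in the span of the family) when the family is linearly independent. -/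
def gvol {n r : ℕ} (v : Fin r → (Fin n → ℝ)) : ℝ :=
  Real.sqrt (Matrix.det (Matrix.of fun i j => einner (v i) (v j)))

/-- `c` is the covolume of `Λ` in its real span, as computed from some ℤ-basis of `Λ` which is
linearly independent over `ℝ`. -/
def covolSpec {n : ℕ} (Λ : AddSubgroup (Fin n → ℝ)) (c : ℝ) : Prop :=
  ∃ (r : ℕ) (v : Fin r → (Fin n → ℝ)), LinearIndependent ℝ v ∧
    Λ = AddSubgroup.closure (Set.range v) ∧ c = gvol v

/-- The covolume of a discrete subgroup `Λ ⊆ ℝⁿ` inside its real span (with `covol ⊥ = 1`). -/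
def covol {n : ℕ} (Λ : AddSubgroup (Fin n → ℝ)) : ℝ := sInf {c | covolSpec Λ c}

/-- The rank of a discrete subgroup of `ℝⁿ`: the dimension of its real span. -/
def rk {n : ℕ} (Λ : AddSubgroup (Fin n → ℝ)) : ℕ :=
  Module.finrank ℝ (Submodule.span ℝ (Λ : Set (Fin n → ℝ)))

/-- A lattice in `ℝⁿ`: a discrete subgroup spanning `ℝⁿ` (equivalently, cocompact). -/
def IsLattice {n : ℕ} (L : AddSubgroup (Fin n → ℝ)) : Prop :=
  DiscreteTopology ↥L ∧ Submodule.span ℝ (L : Set (Fin n → ℝ)) = ⊤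

/-- A unimodular lattice: a lattice of covolume one. -/
def IsUnimodularLattice {n : ℕ} (L : AddSubgroup (Fin n → ℝ)) : Prop :=
  IsLattice L ∧ covol L = 1

/-- A stable lattice: a unimodular lattice all of whose subgroups have covolume at least one. -/
def IsStable {n : ℕ} (L : AddSubgroup (Fin n → ℝ)) : Prop :=
  IsUnimodularLattice L ∧ ∀ Λ : AddSubgroup (Fin n → ℝ), Λ ≤ L → 1 ≤ covol Λ

/-! ### Matrices: the diagonal group `A`, `SL_n(ℤ)`, lattices from matrices -/

/-- The group `A` of positive diagonal matrices of determinant one (as a set of matrices). -/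
def Apos (n : ℕ) : Set (Matrix (Fin n) (Fin n) ℝ) :=
  {a | ∃ d : Fin n → ℝ, (∀ i, 0 < d i) ∧ (∏ i, d i) = 1 ∧ a = Matrix.diagonal d}

/-- `SL_n(ℤ)` viewed as a set of real matrices. -/
def Gam (n : ℕ) : Set (Matrix (Fin n) (Fin n) ℝ) :=
  {γ | γ.det = 1 ∧ ∀ i j, ∃ m : ℤ, γ i j = (m : ℝ)}

/-- The lattice `g·ℤⁿ` associated to a matrix `g`. -/
def latticeOf {n : ℕ} (g : Matrix (Fin n) (Fin n) ℝ) : AddSubgroup (Fin n → ℝ) :=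
  AddSubgroup.closure (Set.range fun m : Fin n → ℤ => g.mulVec fun i => (m i : ℝ))

/-- The image `g·L` of a lattice under a matrix. -/
def mapLat {n : ℕ} (g : Matrix (Fin n) (Fin n) ℝ) (L : AddSubgroup (Fin n → ℝ)) :
    AddSubgroup (Fin n → ℝ) :=
  AddSubgroup.map (Matrix.mulVecLin g).toAddMonoidHom L

/-- The full preimage `A·g·Γ` in `SL_n(ℝ)` of the orbit `A·[g] ⊆ ℒ_n`; a point `[h] ∈ ℒ_n`
lies in the closure of `A·[g]` iff `h ∈ closure (AOrbit g)`. -/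
def AOrbit {n : ℕ} (g : Matrix (Fin n) (Fin n) ℝ) : Set (Matrix (Fin n) (Fin n) ℝ) :=
  {p | ∃ a ∈ Apos n, ∃ γ ∈ Gam n, p = a * g * γ}

/-- The orbit `A·[g] ⊆ ℒ_n` is bounded (has compact closure). -/
def HasBoundedAOrbit {n : ℕ} (g : Matrix (Fin n) (Fin n) ℝ) : Prop :=
  ∃ K : Set (Matrix (Fin n) (Fin n) ℝ), IsCompact K ∧
    ∀ a ∈ Apos n, ∃ γ ∈ Gam n, a * g * γ ∈ K

/-! ### `α`, `Min_δ`, `V_δ`, `dim_δ` -/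

/-- `α(x) = min { |Λ|^{1/r(Λ)} : Λ a nonzero subgroup of x }`. -/
def alpha {n : ℕ} (x : AddSubgroup (Fin n → ℝ)) : ℝ :=
  sInf {c | ∃ Λ : AddSubgroup (Fin n → ℝ), Λ ≤ x ∧ Λ ≠ ⊥ ∧ c = covol Λ ^ ((rk Λ : ℝ)⁻¹)}

/-- `α_k(x) = min { |Λ|^{1/k} : Λ a rank-`k` subgroup of x }`. -/
def alphak {n : ℕ} (k : ℕ) (x : AddSubgroup (Fin n → ℝ)) : ℝ :=
  sInf {c | ∃ Λ : AddSubgroup (Fin n → ℝ), Λ ≤ x ∧ rk Λ = k ∧ c = covol Λ ^ ((k : ℝ)⁻¹)}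

/-- `Min_δ(x)`: nonzero subgroups nearly attaining `α(x)`. -/
def MinSet {n : ℕ} (δ : ℝ) (x : AddSubgroup (Fin n → ℝ)) : Set (AddSubgroup (Fin n → ℝ)) :=
  {Λ | Λ ≤ x ∧ Λ ≠ ⊥ ∧ covol Λ ^ ((rk Λ : ℝ)⁻¹) < (1 + δ) * alpha x}

/-- `V_δ(x)`: the span of the subgroups in `Min_δ(x)`. -/
def Vdelta {n : ℕ} (δ : ℝ) (x : AddSubgroup (Fin n → ℝ)) : Submodule ℝ (Fin n → ℝ) :=
  Submodule.span ℝ (⋃ Λ ∈ MinSet δ x, (Λ : Set (Fin n → ℝ)))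

/-- `dim_δ(x) = dim V_δ(x)`. -/
def dimdelta {n : ℕ} (δ : ℝ) (x : AddSubgroup (Fin n → ℝ)) : ℕ :=
  Module.finrank ℝ (Vdelta δ x)

/-- `U_k^{x,ε} ⊆ A`: those `a` for which `δ ↦ dim_δ(ax)` equals `k` near `kε`. -/
def Uset {n : ℕ} (x : AddSubgroup (Fin n → ℝ)) (ε : ℝ) (k : ℕ) :
    Set (Matrix (Fin n) (Fin n) ℝ) :=
  {a | a ∈ Apos n ∧ ∃ s ∈ 𝓝 ((k : ℝ) * ε), ∀ δ ∈ s, dimdelta δ (mapLat a x) = k}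

/-- Logarithmic coordinates on the diagonal group. -/
def logCoord {n : ℕ} (a : Matrix (Fin n) (Fin n) ℝ) : Fin n → ℝ := fun i => Real.log (a i i)

/-! ### Covering radius -/

/-- The covering radius `covrad(L) = sup_u inf_{v ∈ L} ‖u - v‖`. -/
def covrad {n : ℕ} (L : AddSubgroup (Fin n → ℝ)) : ℝ :=
  ⨆ u : Fin n → ℝ, ⨅ v : L, enorm (u - (v : Fin n → ℝ))

/-- `[g]` is a local maximum of `covrad : ℒ_d → ℝ` (phrased via the open quotient
`SL_d(ℝ) → ℒ_d`). -/
def IsLocalMaxCovrad {d : ℕ} (g : Matrix (Fin d) (Fin d) ℝ) : Prop :=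
  ∃ W ∈ 𝓝 g, ∀ g' ∈ W, Matrix.det g' = 1 → covrad (latticeOf g') ≤ covrad (latticeOf g)

/-! ### Block upper triangular form -/

/-- Offset of the `i`-th diagonal block. -/
def off {k : ℕ} (ns : Fin k → ℕ) (i : Fin k) : ℕ :=
  ∑ j ∈ Finset.univ.filter (fun j => j < i), ns j

lemma off_add_lt {k : ℕ} (ns : Fin k → ℕ) (i : Fin k) (a : Fin (ns i)) :
    off ns i + (a : ℕ) < ∑ j, ns j := by
  unfold off
  have hins : i ∉ Finset.univ.filter (fun j => j < i) := by simp
  have h2 : ∑ j ∈ insert i (Finset.univ.filter (fun j => j < i)), ns j ≤ ∑ j, ns j :=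
    Finset.sum_le_sum_of_subset (Finset.subset_univ _)
  rw [Finset.sum_insert hins] at h2
  have := a.isLt
  omega

/-- The position, in `Fin n`, of the `a`-th coordinate of the `i`-th block. -/
def blockEmb {n k : ℕ} (ns : Fin k → ℕ) (hsum : (∑ j, ns j) = n) (i : Fin k)
    (a : Fin (ns i)) : Fin n :=
  ⟨off ns i + (a : ℕ), hsum ▸ off_add_lt ns i a⟩

/-- `g` is block upper triangular with diagonal blocks `G i` (block sizes `ns`). -/
def IsBlockUT {n k : ℕ} (ns : Fin k → ℕ) (hsum : (∑ j, ns j) = n)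
    (g : Matrix (Fin n) (Fin n) ℝ) (G : ∀ i, Matrix (Fin (ns i)) (Fin (ns i)) ℝ) : Prop :=
  (∀ (i : Fin k) (a b : Fin (ns i)),
      g (blockEmb ns hsum i a) (blockEmb ns hsum i b) = G i a b) ∧
  (∀ (i j : Fin k) (a : Fin (ns i)) (b : Fin (ns j)), j < i →
      g (blockEmb ns hsum i a) (blockEmb ns hsum j b) = 0)

/-! ### Mordell constant -/

/-- The symmetric box `[-a₁,a₁] × ⋯ × [-aₙ,aₙ]` is admissible for `L`: its interior contains
no nonzero point of `L`. -/
def IsAdmissibleBox {n : ℕ} (L : AddSubgroup (Fin n → ℝ)) (a : Fin n → ℝ) : Prop :=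
  (∀ i, 0 < a i) ∧ ∀ v ∈ L, v ≠ 0 → ∃ i, a i ≤ |v i|

/-- The Mordell constant `κ(L) = 2⁻ⁿ sup { Vol(B) : B admissible symmetric box for L }`. -/
def mordellConst {n : ℕ} (L : AddSubgroup (Fin n → ℝ)) : ℝ :=
  (1 / 2 ^ n) * sSup {V | ∃ a : Fin n → ℝ, IsAdmissibleBox L a ∧ V = ∏ i, 2 * a i}

/-! ### Hermite constant -/

/-- Length of a shortest nonzero vector of `L`. -/
def shortest {m : ℕ} (L : AddSubgroup (Fin m → ℝ)) : ℝ :=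
  sInf {t | ∃ w ∈ L, w ≠ 0 ∧ t = enorm w}

/-- The Hermite constant `γ_m`. -/
def hermiteConst (m : ℕ) : ℝ :=
  sSup {c | ∃ L : AddSubgroup (Fin m → ℝ), IsUnimodularLattice L ∧ c = shortest L ^ 2}

/-! ### Korkine–Zolotarev reduction -/

/-- `v 0, …, v (n-1)` is a Korkine–Zolotarev reduced basis of `x`: it is a ℤ-basis, and for
each `i` the orthogonal projection of `v i` onto `span(v 0, …, v (i-1))^⊥` is shortest among the
nonzero such projections of vectors of `x` (projection lengths are expressed through Gram
determinants: the projection of `w` has length `gvol (v 0, …, v (i-1), w) / gvol (v 0, …, v (i-1))`). -/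
def IsKZBasis {n : ℕ} (x : AddSubgroup (Fin n → ℝ)) (v : ℕ → (Fin n → ℝ)) : Prop :=
  LinearIndependent ℝ (fun j : Fin n => v (j : ℕ)) ∧
  x = AddSubgroup.closure (v '' Set.Iio n) ∧
  ∀ i < n, ∀ w ∈ x, w ∉ Submodule.span ℝ (v '' Set.Iio i) →
    gvol (Fin.snoc (fun j : Fin i => v (j : ℕ)) (v i)) ≤
      gvol (Fin.snoc (fun j : Fin i => v (j : ℕ)) w)

/-- `A 0, …, A (n-1)` are the diagonal Korkine–Zolotarev coefficients of `x`: the lengths of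
the successive orthogonal projections in a KZ reduced basis, i.e.
`A i = gvol (v 0, …, v i) / gvol (v 0, …, v (i-1))`. -/
def HasKZCoeffs {n : ℕ} (x : AddSubgroup (Fin n → ℝ)) (A : ℕ → ℝ) : Prop :=
  ∃ v : ℕ → (Fin n → ℝ), IsKZBasis x v ∧
    ∀ i < n, A i * gvol (fun j : Fin i => v (j : ℕ)) = gvol (fun j : Fin (i + 1) => v (j : ℕ))

/-! ### Orthogonal complements and projections of lattices -/

/-- The orthogonal complement of a subspace `V ⊆ ℝⁿ`. -/
def orthoC {n : ℕ} (V : Submodule ℝ (Fin n → ℝ)) : Submodule ℝ (Fin n → ℝ) where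
  carrier := {w | ∀ v ∈ V, einner w v = 0}
  zero_mem' := by intro v hv; simp [einner]
  add_mem' := by intro a b ha hb v hv; rw [einner_add_left, ha v hv, hb v hv, add_zero]
  smul_mem' := by intro c w hw v hv; rw [einner_smul_left, hw v hv, mul_zero]

/-- The image `π(x)` of `x` under the orthogonal projection `π : ℝⁿ → V^⊥`:
`p = π(u)` iff `p ⊥ V` and `u - p ∈ V`. -/
def projLat {n : ℕ} (V : Submodule ℝ (Fin n → ℝ)) (x : AddSubgroup (Fin n → ℝ)) :
    AddSubgroup (Fin n → ℝ) where
  carrier := {p | (∀ v ∈ V, einner p v = 0) ∧ ∃ u ∈ x, u - p ∈ V}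
  zero_mem' := ⟨by intro v hv; simp [einner], 0, x.zero_mem, by rw [sub_zero]; exact V.zero_mem⟩
  add_mem' := by
    rintro p q ⟨hp1, u1, hu1, hp2⟩ ⟨hq1, u2, hu2, hq2⟩
    refine ⟨fun v hv => by rw [einner_add_left, hp1 v hv, hq1 v hv, add_zero],
      u1 + u2, x.add_mem hu1 hu2, ?_⟩
    have h : u1 + u2 - (p + q) = u1 - p + (u2 - q) := by abel
    rw [h]; exact V.add_mem hp2 hq2
  neg_mem' := by
    rintro p ⟨hp1, u, hu, hp2⟩
    refine ⟨fun v hv => by rw [einner_neg_left, hp1 v hv, neg_zero],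
      -u, x.neg_mem hu, ?_⟩
    have h : -u - -p = -(u - p) := by abel
    rw [h]; exact V.neg_mem hp2

end SW

namespace SW

/-- The Gram determinant of the rows of a matrix. -/
def gramDet {ι κ : Type*} [Fintype ι] [DecidableEq ι] [Fintype κ] (v : Matrix ι κ ℝ) : ℝ :=
  (v * vᵀ).det

/-- The matrix of the orthogonal projection onto the row space of a matrix with linearly
independent rows. -/
def rowProj {ι κ : Type*} [Fintype ι] [DecidableEq ι] [Fintype κ] (v : Matrix ι κ ℝ) :
    Matrix κ κ ℝ :=
  vᵀ * (v * vᵀ)⁻¹ * v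

section Gram

variable {ι ι' ι'' κ : Type*} [Fintype ι] [DecidableEq ι] [Fintype ι'] [DecidableEq ι']
  [Fintype ι''] [DecidableEq ι''] [Fintype κ]

lemma posSemidef_mul_transpose {ι κ : Type*} [Fintype ι] [Fintype κ] (v : Matrix ι κ ℝ) :
    (v * vᵀ).PosSemidef := by
  simpa using Matrix.posSemidef_self_mul_conjTranspose v

lemma gramDet_nonneg (v : Matrix ι κ ℝ) : 0 ≤ gramDet v :=
  (posSemidef_mul_transpose v).det_nonneg

lemma gramDet_pos {v : Matrix ι κ ℝ} (hv : LinearIndependent ℝ v.row) : 0 < gramDet v := by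
  have := Matrix.PosDef.mul_conjTranspose_self v (Matrix.vecMul_injective_iff.2 hv)
  simpa [gramDet] using this.det_pos

lemma gramDet_mul (M : Matrix ι ι ℝ) (v : Matrix ι κ ℝ) :
    gramDet (M * v) = M.det ^ 2 * gramDet v := by
  rw [gramDet, gramDet, transpose_mul, Matrix.mul_assoc, ← Matrix.mul_assoc v, ← Matrix.mul_assoc,
    det_mul, det_mul, det_transpose]
  ring

lemma rowProj_transpose (v : Matrix ι κ ℝ) : (rowProj v)ᵀ = rowProj v := by
  simp [rowProj, Matrix.transpose_mul, Matrix.transpose_nonsing_inv, Matrix.mul_assoc]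

lemma mul_rowProj {v : Matrix ι κ ℝ} (hv : gramDet v ≠ 0) : v * rowProj v = v := by
  have : IsUnit (v * vᵀ).det := isUnit_iff_ne_zero.2 hv
  rw [rowProj, ← Matrix.mul_assoc, ← Matrix.mul_assoc, Matrix.mul_nonsing_inv _ this,
    Matrix.one_mul]

lemma rowProj_mul_of_mul {v : Matrix ι κ ℝ} {P : Matrix κ κ ℝ} (h : v * P = v) :
    rowProj v * P = rowProj v := by
  rw [rowProj, Matrix.mul_assoc, h]

lemma rowProj_mul_self {v : Matrix ι κ ℝ} (hv : gramDet v ≠ 0) :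
    rowProj v * rowProj v = rowProj v := rowProj_mul_of_mul (mul_rowProj hv)

lemma trace_rowProj {v : Matrix ι κ ℝ} (hv : gramDet v ≠ 0) :
    (rowProj v).trace = Fintype.card ι := by
  have : IsUnit (v * vᵀ).det := isUnit_iff_ne_zero.2 hv
  rw [rowProj, Matrix.mul_assoc, Matrix.trace_mul_comm, Matrix.mul_assoc,
    Matrix.nonsing_inv_mul _ this, Matrix.trace_one]

/-- The spectral theorem for real symmetric matrices, in matrix form. -/
lemma exists_orthogonal_diagonalization {A : Matrix ι ι ℝ} (hA : Aᵀ = A) :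
    ∃ (U : Matrix ι ι ℝ) (l : ι → ℝ), Uᵀ * U = 1 ∧ U * Uᵀ = 1 ∧ Uᵀ * A * U = diagonal l ∧
      A.det = ∏ i, l i := by
  have hH : A.IsHermitian := by rwa [Matrix.IsHermitian, conjTranspose_eq_transpose_of_trivial]
  have hU := hH.eigenvectorUnitary.2
  rw [Matrix.mem_unitaryGroup_iff', Matrix.star_eq_conjTranspose,
    conjTranspose_eq_transpose_of_trivial] at hU
  have hU' := mul_eq_one_comm.1 hU
  refine ⟨hH.eigenvectorUnitary, hH.eigenvalues, hU, hU', ?_, ?_⟩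
  · have h := hH.conjStarAlgAut_star_eigenvectorUnitary
    simpa [Unitary.conjStarAlgAut_apply, Matrix.star_eq_conjTranspose,
      conjTranspose_eq_transpose_of_trivial] using h
  · simpa using hH.det_eq_prod_eigenvalues

lemma diagonalization_apply {A U : Matrix ι ι ℝ} {l : ι → ℝ} (h : Uᵀ * A * U = diagonal l)
    (i : ι) : l i = U.col i ⬝ᵥ A *ᵥ U.col i := by
  have := congrFun (congrFun h i) i
  rw [diagonal_apply_eq, Matrix.mul_assoc] at this
  rw [← this]
  simp [Matrix.mul_apply, dotProduct, mulVec, Finset.mul_sum]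

lemma one_le_det_one_add {Y : Matrix ι ι ℝ} (hY : Y.PosSemidef) : 1 ≤ (1 + Y).det := by
  have hYt : Yᵀ = Y := by simpa [conjTranspose_eq_transpose_of_trivial] using hY.1.eq
  obtain ⟨U, l, hU, hU', hd, hdet⟩ := exists_orthogonal_diagonalization hYt
  have h1 : Uᵀ * (1 + Y) * U = diagonal (1 + l) := by
    rw [Matrix.mul_add, Matrix.add_mul, hd, Matrix.mul_one, hU, ← diagonal_one, diagonal_add]
    rfl
  have h2 := congrArg det h1
  rw [det_mul_comm, ← Matrix.mul_assoc, hU', Matrix.one_mul, det_diagonal] at h2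
  rw [h2]
  have : ∀ i ∈ Finset.univ, (1 : ℝ) ≤ (1 + l) i := fun i _ => by
    have := hY.dotProduct_mulVec_nonneg (U.col i)
    rw [star_trivial, ← diagonalization_apply hd] at this
    simpa using this
  calc (1 : ℝ) = ∏ i : ι, 1 := by simp
    _ ≤ _ := Finset.prod_le_prod (fun _ _ => zero_le_one) this

lemma exists_transpose_mul_self {S : Matrix ι ι ℝ} (hS : S.PosSemidef) :
    ∃ C : Matrix ι ι ℝ, S = Cᵀ * C := by
  have hSt : Sᵀ = S := by simpa [conjTranspose_eq_transpose_of_trivial] using hS.1.eq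
  obtain ⟨U, l, hU, hU', hd, hdet⟩ := exists_orthogonal_diagonalization hSt
  refine ⟨diagonal (fun i => √(l i)) * Uᵀ, ?_⟩
  have hl : ∀ i, √(l i) * √(l i) = l i := fun i => Real.mul_self_sqrt <| by
    have := hS.dotProduct_mulVec_nonneg (U.col i)
    rwa [star_trivial, ← diagonalization_apply hd] at this
  rw [transpose_mul, transpose_transpose, diagonal_transpose, Matrix.mul_assoc U,
    ← Matrix.mul_assoc (diagonal _), diagonal_mul_diagonal]
  simp only [hl]
  rw [← hd]
  simp only [← Matrix.mul_assoc, hU', Matrix.one_mul]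
  rw [Matrix.mul_assoc, hU', Matrix.mul_one]

lemma det_le_det_add {S X : Matrix ι ι ℝ} (hS : S.PosSemidef) (hX : X.PosSemidef) :
    S.det ≤ (S + X).det := by
  by_cases h0 : S.det = 0
  · rw [h0]; exact (hS.add hX).det_nonneg
  obtain ⟨C, hC⟩ := exists_transpose_mul_self hS
  have hCu : IsUnit C.det := by
    rw [isUnit_iff_ne_zero]
    rintro h
    apply h0
    rw [hC, det_mul, h, mul_zero]
  have : S + X = Cᵀ * (1 + C⁻¹ᵀ * X * C⁻¹) * C := by
    rw [Matrix.mul_add, Matrix.add_mul, Matrix.mul_one, hC]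
    congr 1
    rw [Matrix.mul_assoc, Matrix.mul_assoc, Matrix.mul_assoc, Matrix.nonsing_inv_mul _ hCu,
      Matrix.mul_one, ← Matrix.mul_assoc, ← transpose_mul, Matrix.nonsing_inv_mul _ hCu,
      transpose_one, Matrix.one_mul]
  rw [this, det_mul, det_mul, hC, det_mul, det_transpose]
  have h1 := one_le_det_one_add (hX.conjTranspose_mul_mul_same C⁻¹)
  rw [conjTranspose_eq_transpose_of_trivial] at h1
  nlinarith [mul_self_nonneg C.det]

lemma one_sub_mul_one_sub [DecidableEq κ] {P : Matrix κ κ ℝ} (hP : P * P = P) :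
    (1 - P) * (1 - P) = 1 - P := by
  rw [Matrix.sub_mul, Matrix.mul_sub, Matrix.mul_sub, hP]; simp

lemma gramDet_fromRows [DecidableEq κ] {z : Matrix ι κ ℝ} (hz : gramDet z ≠ 0) (y : Matrix ι' κ ℝ) :
    gramDet (fromRows z y) = gramDet z * gramDet (y * (1 - rowProj z)) := by
  have hu : IsUnit (z * zᵀ).det := isUnit_iff_ne_zero.2 hz
  let _ := Matrix.invertibleOfIsUnitDet _ hu
  have hP : (1 - rowProj z) * (1 - rowProj z) = 1 - rowProj z :=
    one_sub_mul_one_sub (rowProj_mul_self hz)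
  rw [gramDet, gramDet, gramDet, transpose_fromRows, fromRows_mul_fromCols, det_fromBlocks₁₁]
  congr 2
  rw [transpose_mul, transpose_sub, rowProj_transpose, transpose_one,
    Matrix.mul_assoc y (1 - rowProj z), ← Matrix.mul_assoc (1 - rowProj z) _ yᵀ, hP,
    Matrix.invOf_eq_nonsing_inv, rowProj]
  simp only [Matrix.sub_mul, Matrix.mul_sub, Matrix.mul_assoc, Matrix.one_mul]

lemma gramDet_mul_one_sub_le [DecidableEq κ] (y : Matrix ι' κ ℝ) {P : Matrix κ κ ℝ} (hP : Pᵀ = P)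
    (hPP : P * P = P) : gramDet (y * (1 - P)) ≤ gramDet y := by
  have hQ : (1 - P) * (1 - P) = 1 - P := one_sub_mul_one_sub hPP
  have : y * yᵀ = y * (1 - P) * (y * (1 - P))ᵀ + y * P * (y * P)ᵀ := by
    rw [transpose_mul, transpose_mul, transpose_sub, hP, transpose_one, Matrix.mul_assoc,
      ← Matrix.mul_assoc (1 - P) _ yᵀ, hQ, Matrix.mul_assoc y P, ← Matrix.mul_assoc P, hPP]
    simp [Matrix.sub_mul, Matrix.mul_sub]
  rw [gramDet, gramDet, this]
  exact det_le_det_add (posSemidef_mul_transpose _) (posSemidef_mul_transpose _)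

/-- Fischer's inequality. -/
lemma gramDet_fromRows_le [DecidableEq κ] {p : Matrix ι κ ℝ} (hp : gramDet p ≠ 0)
    (q : Matrix ι' κ ℝ) :
    gramDet (fromRows p q) ≤ gramDet p * gramDet q := by
  rw [gramDet_fromRows hp]
  exact mul_le_mul_of_nonneg_left
    (gramDet_mul_one_sub_le q (rowProj_transpose p) (rowProj_mul_self hp)) (gramDet_nonneg p)

/-- Submodularity of the logarithm of the covolume. -/
lemma gramDet_submodular [DecidableEq κ] {z : Matrix ι κ ℝ} {p : Matrix ι' κ ℝ} (q : Matrix ι'' κ ℝ)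
    (hzp : gramDet (fromRows z p) ≠ 0) (hz : gramDet z ≠ 0) :
    gramDet (fromRows z (fromRows p q)) * gramDet z ≤
      gramDet (fromRows z p) * gramDet (fromRows z q) := by
  rw [gramDet_fromRows hz] at hzp ⊢
  rw [gramDet_fromRows hz, gramDet_fromRows hz, fromRows_mul]
  have := gramDet_fromRows_le (right_ne_zero_of_mul hzp) (q * (1 - rowProj z))
  have h0 := gramDet_nonneg z
  nlinarith [mul_nonneg h0 h0]

lemma gramDet_reindex (e : ι' ≃ ι) (v : Matrix ι κ ℝ) : gramDet (v.submatrix e id) = gramDet v := by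
  have : v.submatrix e id * (v.submatrix e id)ᵀ = (v * vᵀ).submatrix e e := by
    ext i j; simp [Matrix.mul_apply]
  rw [gramDet, this, det_submatrix_equiv_self, gramDet]

end Gram

/-- The factor by which the squared covolume of a subspace with orthogonal projection `P` is
changed by the diagonal matrix with entries `√(d i)`. -/
def volFactor {κ : Type*} [Fintype κ] [DecidableEq κ] (P : Matrix κ κ ℝ) (d : κ → ℝ) : ℝ :=
  (1 + P * (diagonal d - 1)).det

/-- Symmetric idempotent matrices, i.e. orthogonal projections. -/
def IsOrthProj {κ : Type*} [Fintype κ] (P : Matrix κ κ ℝ) : Prop :=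
  Pᵀ = P ∧ P * P = P

section VolFactor

set_option linter.unusedSectionVars false

variable {ι κ : Type*} [Fintype ι] [DecidableEq ι] [Fintype κ] [DecidableEq κ]

lemma isOrthProj_rowProj {v : Matrix ι κ ℝ} (hv : gramDet v ≠ 0) : IsOrthProj (rowProj v) :=
  ⟨rowProj_transpose v, rowProj_mul_self hv⟩

lemma gramDet_mul_diagonal {v : Matrix ι κ ℝ} (hv : gramDet v ≠ 0) (e : κ → ℝ) :
    gramDet (v * diagonal e) = gramDet v * volFactor (rowProj v) (fun j => e j * e j) := by
  have hu : IsUnit (v * vᵀ).det := isUnit_iff_ne_zero.2 hv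
  have h1 : v * diagonal e * (v * diagonal e)ᵀ =
      (v * vᵀ) * (1 + ((v * vᵀ)⁻¹ * v * (diagonal (fun j => e j * e j) - 1)) * vᵀ) := by
    rw [transpose_mul, diagonal_transpose, Matrix.mul_assoc v, ← Matrix.mul_assoc (diagonal e),
      diagonal_mul_diagonal, Matrix.mul_add, Matrix.mul_one, Matrix.mul_assoc (v * vᵀ)⁻¹,
      Matrix.mul_assoc (v * vᵀ)⁻¹, ← Matrix.mul_assoc (v * vᵀ) (v * vᵀ)⁻¹,
      Matrix.mul_nonsing_inv _ hu, Matrix.one_mul, Matrix.mul_sub, Matrix.sub_mul, Matrix.mul_one,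
      Matrix.mul_assoc v]
    abel
  rw [gramDet, h1, det_mul, det_one_add_mul_comm, volFactor, rowProj, gramDet]
  simp only [Matrix.mul_assoc]

lemma IsOrthProj.diag_nonneg {P : Matrix κ κ ℝ} (hP : IsOrthProj P) (j : κ) : 0 ≤ P j j := by
  have h : P j j = ∑ i, P i j ^ 2 := by
    conv_lhs => rw [← hP.2]
    refine Finset.sum_congr rfl fun i _ => ?_
    have := congrFun (congrFun hP.1 i) j
    rw [transpose_apply] at this
    simp only [this, sq]
  rw [h]; positivity

lemma IsOrthProj.one_sub {P : Matrix κ κ ℝ} (hP : IsOrthProj P) : IsOrthProj (1 - P) :=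
  ⟨by rw [transpose_sub, hP.1, transpose_one], one_sub_mul_one_sub hP.2⟩

lemma IsOrthProj.diag_le_one {P : Matrix κ κ ℝ} (hP : IsOrthProj P) (j : κ) : P j j ≤ 1 := by
  have := hP.one_sub.diag_nonneg j
  simpa using this

lemma exp_sum_le {w h : κ → ℝ} (hw : ∀ j, 0 ≤ w j) (hw1 : ∑ j, w j ≤ 1) :
    Real.exp (∑ j, w j * h j) ≤ 1 + ∑ j, w j * (Real.exp (h j) - 1) ∧
    (Real.exp (∑ j, w j * h j) = 1 + ∑ j, w j * (Real.exp (h j) - 1) →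
      ∀ j, w j ≠ 0 → h j = ∑ j, w j * h j) := by
  set m := ∑ j, w j * h j with hm
  have key : 1 + ∑ j, w j * (Real.exp (h j) - 1) - Real.exp m =
      Real.exp m * (∑ j, w j * (Real.exp (h j - m) - (h j - m + 1)) +
        (1 - ∑ j, w j) * (Real.exp (-m) - (-m + 1))) := by
    have e1 : ∀ j, Real.exp m * (w j * (Real.exp (h j - m) - (h j - m + 1))) =
        w j * (Real.exp (h j) - 1) + w j - Real.exp m * (w j * h j) +
          (Real.exp m * m - Real.exp m) * w j := fun j => by
      have : Real.exp (h j) = Real.exp m * Real.exp (h j - m) := by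
        rw [← Real.exp_add]; congr 1; ring
      rw [this]; ring
    have e2 : Real.exp m * Real.exp (-m) = 1 := by rw [← Real.exp_add]; simp
    rw [mul_add, Finset.mul_sum]
    simp only [e1, Finset.sum_add_distrib, Finset.sum_sub_distrib, ← Finset.mul_sum, ← hm]
    linear_combination (-(1 - ∑ j, w j)) * e2
  have hj : ∀ j ∈ Finset.univ, 0 ≤ w j * (Real.exp (h j - m) - (h j - m + 1)) := fun j _ =>
    mul_nonneg (hw j) (sub_nonneg.2 (Real.add_one_le_exp _))
  have hr : 0 ≤ (1 - ∑ j, w j) * (Real.exp (-m) - (-m + 1)) :=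
    mul_nonneg (sub_nonneg.2 hw1) (sub_nonneg.2 (Real.add_one_le_exp _))
  refine ⟨?_, fun heq j hwj => ?_⟩
  · rw [← sub_nonneg, key]
    exact mul_nonneg (Real.exp_pos _).le (add_nonneg (Finset.sum_nonneg hj) hr)
  · by_contra hne
    rw [← heq, sub_self] at key
    have h1 : 0 < w j * (Real.exp (h j - m) - (h j - m + 1)) :=
      mul_pos (lt_of_le_of_ne (hw j) (Ne.symm hwj))
        (sub_pos.2 (Real.add_one_lt_exp (sub_ne_zero.2 hne)))
    have h2 := Finset.single_le_sum hj (Finset.mem_univ j)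
    have := mul_pos (Real.exp_pos m) (add_pos_of_pos_of_nonneg (h1.trans_le h2) hr)
    linarith

lemma volFactor_exp {P : Matrix κ κ ℝ} (hP : IsOrthProj P) (h : κ → ℝ) :
    Real.exp (∑ j, P j j * h j) ≤ volFactor P (fun j => Real.exp (h j)) ∧
    (Real.exp (∑ j, P j j * h j) = volFactor P (fun j => Real.exp (h j)) →
      ∀ i j, P i j ≠ 0 → h i = h j) := by
  set d : κ → ℝ := fun j => Real.exp (h j) with hd
  have e1 : volFactor P d = (1 + P * (diagonal d - 1) * P).det := by
    rw [volFactor]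
    conv_lhs => rw [← hP.2, Matrix.mul_assoc, det_one_add_mul_comm]
  have hsym : (1 + P * (diagonal d - 1) * P)ᵀ = 1 + P * (diagonal d - 1) * P := by
    simp [transpose_mul, hP.1, Matrix.mul_assoc]
  obtain ⟨U, l, hU, hU', hUl, hdet⟩ := exists_orthogonal_diagonalization hsym
  set W := P * U with hW
  have hl : ∀ i, l i = 1 + ∑ j, W j i ^ 2 * (d j - 1) := fun i => by
    have := congrFun (congrFun hUl i) i
    rw [diagonal_apply_eq] at this
    rw [← this]
    have e2 : Uᵀ * (1 + P * (diagonal d - 1) * P) * U =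
        1 + Wᵀ * diagonal (fun j => d j - 1) * W := by
      rw [hW, transpose_mul, hP.1, Matrix.mul_add, Matrix.add_mul, Matrix.mul_one, hU,
        ← diagonal_one, diagonal_sub]
      simp only [Matrix.mul_assoc]
    rw [e2, Matrix.add_apply, one_apply_eq, Matrix.mul_apply]
    congr 1
    refine Finset.sum_congr rfl fun j _ => ?_
    rw [mul_diagonal, transpose_apply]; ring
  have hWi : ∀ i, ∑ j, W j i ^ 2 ≤ 1 := fun i => by
    have e3 : 1 - Wᵀ * W = ((1 - P) * U)ᵀ * ((1 - P) * U) := by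
      rw [transpose_mul (1 - P), hP.one_sub.1, Matrix.mul_assoc, ← Matrix.mul_assoc (1 - P),
        hP.one_sub.2,
        Matrix.sub_mul, Matrix.mul_sub, Matrix.one_mul, hU, hW, transpose_mul, hP.1,
        Matrix.mul_assoc, ← Matrix.mul_assoc P, hP.2]
    have := congrFun (congrFun e3 i) i
    rw [Matrix.sub_apply, one_apply_eq, Matrix.mul_apply, Matrix.mul_apply] at this
    have h2 : 0 ≤ ∑ j, ((1 - P) * U)ᵀ i j * ((1 - P) * U) j i :=
      Finset.sum_nonneg fun j _ => by rw [transpose_apply]; exact mul_self_nonneg _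
    rw [← this] at h2
    simp only [transpose_apply, ← sq] at h2
    linarith
  have hWj : ∀ j, ∑ i, W j i ^ 2 = P j j := fun j => by
    have e4 : W * Wᵀ = P := by
      rw [hW, transpose_mul, Matrix.mul_assoc, ← Matrix.mul_assoc U, hU', Matrix.one_mul, hP.1,
        hP.2]
    conv_rhs => rw [← e4, Matrix.mul_apply]
    exact Finset.sum_congr rfl fun i _ => by rw [transpose_apply, sq]
  have hm : ∑ j, P j j * h j = ∑ i, ∑ j, W j i ^ 2 * h j := by
    rw [Finset.sum_comm]
    exact Finset.sum_congr rfl fun j _ => by rw [← hWj, Finset.sum_mul]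
  have hJ := fun i => exp_sum_le (w := fun j => W j i ^ 2) (h := h) (fun j => sq_nonneg _) (hWi i)
  rw [e1, hdet, hm, Real.exp_sum]
  refine ⟨Finset.prod_le_prod (fun i _ => (Real.exp_pos _).le)
    fun i _ => by rw [hl]; exact (hJ i).1, fun heq => ?_⟩
  have hall : ∀ i, Real.exp (∑ j, W j i ^ 2 * h j) = l i := by
    by_contra hne
    push Not at hne
    obtain ⟨i, hi⟩ := hne
    have hle : ∀ i, Real.exp (∑ j, W j i ^ 2 * h j) ≤ l i := fun i => by
      rw [hl]; exact (hJ i).1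
    exact (Finset.prod_lt_prod (f := fun i => Real.exp (∑ j, W j i ^ 2 * h j))
      (fun i _ => Real.exp_pos _) (fun i _ => hle i)
      ⟨i, Finset.mem_univ i, lt_of_le_of_ne (hle i) hi⟩).ne heq
  have hcm : ∀ i j, W j i ≠ 0 → h j = ∑ j, W j i ^ 2 * h j := fun i j hne =>
    (hJ i).2 (by rw [hall, hl]) j (pow_ne_zero 2 hne)
  have hDW : diagonal h * W = W * diagonal (fun i => ∑ j, W j i ^ 2 * h j) := by
    ext j i
    rw [diagonal_mul, mul_diagonal]
    by_cases h0 : W j i = 0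
    · simp [h0]
    · rw [← hcm i j h0, mul_comm]
  have hDP : diagonal h * P = P * (diagonal h * P) := by
    have : diagonal h * P = W * diagonal (fun i => ∑ j, W j i ^ 2 * h j) * Uᵀ := by
      rw [← hDW, hW, Matrix.mul_assoc, Matrix.mul_assoc, hU', Matrix.mul_one]
    rw [this, ← Matrix.mul_assoc, ← Matrix.mul_assoc]
    rw [hW, ← Matrix.mul_assoc P P, hP.2]
  have hPD : diagonal h * P = P * diagonal h := by
    have := congrArg transpose hDP
    simp only [transpose_mul, hP.1, diagonal_transpose] at this
    rw [hDP, this, Matrix.mul_assoc]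
  intro i j hij
  have := congrFun (congrFun hPD i) j
  rw [diagonal_mul, mul_diagonal, mul_comm] at this
  exact mul_left_cancel₀ hij this

lemma volFactor_mul {P : Matrix κ κ ℝ} (hP : IsOrthProj P) {d : κ → ℝ}
    (hd : ∀ i j, P i j ≠ 0 → d i = d j) (e : κ → ℝ) :
    volFactor P (fun j => d j * e j) = volFactor P d * volFactor P e := by
  have hc : P * diagonal d = diagonal d * P := by
    ext i j
    rw [diagonal_mul, mul_diagonal]
    by_cases h0 : P i j = 0
    · simp [h0]
    · rw [hd i j h0, mul_comm]
  have hc2 : P * (diagonal d * P) = P * diagonal d := by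
    rw [← hc, ← Matrix.mul_assoc, hP.2]
  rw [volFactor, volFactor, volFactor, ← det_mul, ← diagonal_mul_diagonal]
  congr 1
  have hc3 : P * (diagonal d * (P * diagonal e)) = P * (diagonal d * diagonal e) := by
    rw [← Matrix.mul_assoc (diagonal d), ← Matrix.mul_assoc P, hc2, Matrix.mul_assoc]
  have hc4 : P * (P * diagonal e) = P * diagonal e := by rw [← Matrix.mul_assoc, hP.2]
  simp only [Matrix.mul_add, Matrix.add_mul, Matrix.mul_sub, Matrix.sub_mul, Matrix.mul_one,
    Matrix.one_mul, Matrix.mul_assoc, hc2, hP.2, hc3, hc4]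
  abel

lemma volFactor_one (P : Matrix κ κ ℝ) : volFactor P (fun _ => 1) = 1 := by
  have : diagonal (fun _ : κ => (1 : ℝ)) = 1 := diagonal_one
  simp [volFactor, this]

lemma volFactor_exp_eq_one {P : Matrix κ κ ℝ} (hP : IsOrthProj P) {h : κ → ℝ}
    (hc : ∀ i j, P i j ≠ 0 → h i = h j) (h0 : ∑ j, P j j * h j = 0) :
    volFactor P (fun j => Real.exp (h j)) = 1 := by
  have h1 := (volFactor_exp hP h).1
  have h2 := (volFactor_exp hP (-h)).1
  have h3 : ∑ j, P j j * (-h) j = 0 := by simp [h0]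
  rw [h0, Real.exp_zero] at h1
  rw [h3, Real.exp_zero] at h2
  have h4 := volFactor_mul hP (d := fun j => Real.exp (h j))
    (fun i j hij => by simp only [hc i j hij])
    (fun j => Real.exp ((-h) j))
  have h5 : (fun j => Real.exp (h j) * Real.exp ((-h) j)) = fun _ => 1 := by
    ext j; rw [← Real.exp_add]; simp
  rw [h5, volFactor_one] at h4
  nlinarith

lemma continuous_volFactor :
    Continuous fun p : Matrix κ κ ℝ × (κ → ℝ) => volFactor p.1 p.2 := by
  unfold volFactor
  fun_prop

end VolFactor

section Direction

set_option linter.unusedSectionVars false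

variable {κ : Type*} [Fintype κ] [DecidableEq κ]

lemma finrank_span_le_of_commute {S : Set (Matrix κ κ ℝ)} (hS : ∀ A ∈ S, Aᵀ = A)
    (hc : ∀ A ∈ S, ∀ B ∈ S, A * B = B * A) :
    Module.finrank ℝ (Submodule.span ℝ S) ≤ Fintype.card κ := by
  let T : S → EuclideanSpace ℝ κ →ₗ[ℝ] EuclideanSpace ℝ κ := fun A => toEuclideanLin A.1
  have hT : ∀ A, (T A).IsSymmetric := fun A => by
    rw [isSymmetric_toEuclideanLin_iff, Matrix.IsHermitian,
      conjTranspose_eq_transpose_of_trivial]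
    exact hS A.1 A.2
  have hTc : ∀ A B, Commute (T A) (T B) := fun A B => by
    ext x : 1
    have : A.1 *ᵥ B.1 *ᵥ x.ofLp = B.1 *ᵥ A.1 *ᵥ x.ofLp := by
      rw [mulVec_mulVec, mulVec_mulVec, hc A.1 A.2 B.1 B.2]
    simp [T, toLpLin_apply, this]
  have htop := LinearMap.IsSymmetric.iSup_iInf_eq_top_of_commute hT fun A B _ => hTc A B
  let J : Set (EuclideanSpace ℝ κ) :=
    ⋃ χ : S → ℝ, ((⨅ A, Module.End.eigenspace (T A) (χ A) : Submodule ℝ _) : Set _)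
  have hJ : ⊤ ≤ Submodule.span ℝ J := by
    rw [Submodule.span_iUnion, ← htop]
    exact iSup_mono fun χ => Submodule.subset_span
  let b := Module.Basis.ofSpan hJ
  have hb : ∀ i, ∀ A ∈ Submodule.span ℝ S, ∃ c : ℝ, toEuclideanLin A (b i) = c • b i := by
    intro i A hA
    have hi : (b i) ∈ J := by
      apply Module.Basis.ofSpan_subset hJ
      exact ⟨i, rfl⟩
    obtain ⟨χ, hχ⟩ := Set.mem_iUnion.1 hi
    rw [SetLike.mem_coe, Submodule.mem_iInf] at hχ
    induction hA using Submodule.span_induction with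
    | mem A hA => exact ⟨χ ⟨A, hA⟩, Module.End.mem_eigenspace_iff.1 (hχ ⟨A, hA⟩)⟩
    | zero => exact ⟨0, by simp⟩
    | add A B _ _ hA hB =>
      obtain ⟨a, ha⟩ := hA
      obtain ⟨b, hb⟩ := hB
      exact ⟨a + b, by rw [map_add, LinearMap.add_apply, ha, hb, add_smul]⟩
    | smul r A _ hA =>
      obtain ⟨a, ha⟩ := hA
      exact ⟨r * a, by rw [map_smul, LinearMap.smul_apply, ha, smul_smul]⟩
  let _ := FiniteDimensional.fintypeBasisIndex b
  let Φ : Submodule.span ℝ S →ₗ[ℝ] EuclideanSpace ℝ κ :=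
    ((LinearMap.applyₗ (∑ i, b i)).comp (toEuclideanLin (𝕜 := ℝ) (m := κ) (n := κ)).toLinearMap).comp
      (Submodule.span ℝ S).subtype
  have hΦ : Function.Injective Φ := by
    rw [← LinearMap.ker_eq_bot, LinearMap.ker_eq_bot']
    rintro ⟨A, hA⟩ h0
    choose c hcA using fun i => hb i A hA
    have h1 : ∑ i, c i • b i = 0 := by
      rw [← h0]
      change _ = toEuclideanLin A (∑ i, b i)
      simp only [map_sum, hcA]
    have h2 := Fintype.linearIndependent_iff.1 b.linearIndependent c h1
    have h3 : toEuclideanLin A = 0 := b.ext fun i => by rw [hcA, h2]; simp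
    exact Subtype.ext ((LinearEquiv.map_eq_zero_iff _).1 h3)
  simpa using LinearMap.finrank_le_finrank_of_injective hΦ

lemma exists_maximal_proj {ι : Type*} {P : ι → Matrix κ κ ℝ} {T : Finset ι} (hT : T.Nonempty)
    (hP : ∀ i ∈ T, IsOrthProj (P i))
    (hcomp : ∀ i ∈ T, ∀ j ∈ T, P i * P j = P i ∨ P i * P j = P j) :
    ∃ i₀ ∈ T, ∀ i ∈ T, P i * P i₀ = P i := by
  induction hT using Finset.Nonempty.cons_induction with
  | singleton a => exact ⟨a, by simp, by simpa using (hP a (by simp)).2⟩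
  | cons a s ha hs ih =>
    obtain ⟨i, hi, him⟩ := ih (fun i hi => hP i (by simp [hi]))
      (fun i hi j hj => hcomp i (by simp [hi]) j (by simp [hj]))
    have hPa := hP a (by simp)
    have hPi := hP i (by simp [hi])
    rcases hcomp a (by simp) i (by simp [hi]) with h | h
    · refine ⟨i, by simp [hi], fun j hj => ?_⟩
      rcases Finset.mem_cons.1 hj with rfl | hj
      · exact h
      · exact him j hj
    · have h' : P i * P a = P i := by
        have := congrArg transpose h
        rwa [transpose_mul, hPa.1, hPi.1] at this
      refine ⟨a, by simp, fun j hj => ?_⟩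
      rcases Finset.mem_cons.1 hj with rfl | hj
      · exact hPa.2
      · rw [← him j hj, Matrix.mul_assoc, h']

lemma exists_direction {ι : Type*} {P : ι → Matrix κ κ ℝ} {T : Finset ι} (hT : T.Nonempty)
    (hP : ∀ i ∈ T, IsOrthProj (P i))
    (hcomp : ∀ i ∈ T, ∀ j ∈ T, P i * P j = P i ∨ P i * P j = P j)
    (htr : ∀ i ∈ T, 0 < (P i).trace ∧ (P i).trace < Fintype.card κ) :
    ∃ h : κ → ℝ, ∑ j, h j = 0 ∧ (∀ i ∈ T, 0 ≤ ∑ j, P i j j * h j) ∧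
      ∃ i ∈ T, 0 < ∑ j, P i j j * h j ∨ ¬ ∀ a b, P i a b ≠ 0 → h a = h b := by
  by_contra! hcon
  set G : Set (Matrix κ κ ℝ) := insert 1 (P '' T) with hG
  set V := Submodule.span ℝ G with hV
  have h1 : (1 : Matrix κ κ ℝ) ∈ V := Submodule.subset_span (by simp [hG])
  have hPi : ∀ i ∈ T, P i ∈ V := fun i hi => Submodule.subset_span (by
    right; exact ⟨i, hi, rfl⟩)
  let δ : V →ₗ[ℝ] (κ → ℝ) := (Matrix.diagLinearMap κ ℝ ℝ).comp V.subtype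
  have hδ : ∀ M j, δ M j = M.1 j j := fun M j => rfl
  by_cases hinj : LinearMap.ker δ = ⊥
  · obtain ⟨g, hg⟩ := LinearMap.exists_leftInverse_of_injective δ hinj
    obtain ⟨i₀, hi₀, hmax⟩ := exists_maximal_proj hT hP hcomp
    obtain ⟨a, ha⟩ : ∃ a, (1 - P i₀) a a ≠ 0 := by
      by_contra! h0
      have : (1 - P i₀).trace = 0 := Finset.sum_eq_zero fun a _ => h0 a
      rw [trace_sub, trace_one] at this
      have := (htr i₀ hi₀).2
      linarith
    let u := (1 - P i₀) *ᵥ Pi.single a 1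
    have hu : 0 < u ⬝ᵥ u := by
      have hne : u ≠ 0 := fun h => ha (by
        have := congrFun h a
        simpa [u] using this)
      have := Matrix.dotProduct_star_self_pos_iff (v := u).2 hne
      simpa using this
    have hPu : ∀ i ∈ T, P i *ᵥ u = 0 := fun i hi => by
      simp only [u]
      rw [mulVec_mulVec, Matrix.mul_sub, hmax i hi, Matrix.mul_one, sub_self, zero_mulVec]
    let ℓ : Matrix κ κ ℝ →ₗ[ℝ] ℝ :=
      { toFun := fun M => M.trace * (u ⬝ᵥ u) - Fintype.card κ * (u ⬝ᵥ M *ᵥ u)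
        map_add' := fun M N => by rw [trace_add, add_mulVec, dotProduct_add]; ring
        map_smul' := fun r M => by
          rw [trace_smul, smul_mulVec, dotProduct_smul]; simp; ring }
    let f : (κ → ℝ) →ₗ[ℝ] ℝ := (ℓ.comp V.subtype).comp g
    have hf : ∀ M (hM : M ∈ V), ∑ j, M j j * f (Pi.single j 1) = ℓ M := fun M hM => by
      have e1 : f (δ ⟨M, hM⟩) = ℓ M := by
        simp only [f, LinearMap.comp_apply]
        rw [← LinearMap.comp_apply g, hg]; rfl
      rw [← e1, LinearMap.pi_apply_eq_sum_univ f]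
      refine Finset.sum_congr rfl fun j _ => ?_
      rw [hδ, smul_eq_mul]
      congr 2
      ext i
      simp [Pi.single_apply, eq_comm]
    have hℓ : ∀ i ∈ T, 0 < ℓ (P i) := fun i hi => by
      simp only [ℓ, LinearMap.coe_mk, AddHom.coe_mk, hPu i hi]
      simpa using mul_pos (htr i hi).1 hu
    obtain ⟨i, hi⟩ := hT
    have hs : ∑ j, f (Pi.single j 1) = 0 := by
      have := hf 1 h1
      simp only [one_apply_eq, one_mul] at this
      rw [this]
      simp [ℓ]
    have := (hcon (fun j => f (Pi.single j 1)) hs (fun i hi => by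
      rw [hf _ (hPi i hi)]; exact (hℓ i hi).le) i hi).1
    rw [hf _ (hPi i hi)] at this
    exact absurd (hℓ i hi) (not_lt.2 this)
  · let Ψ : (κ → ℝ) →ₗ[ℝ] Module.Dual ℝ (LinearMap.range δ) :=
      (LinearMap.range δ).subtype.dualMap.comp (dotProductEquiv ℝ κ).toLinearMap
    let K := LinearMap.ker Ψ
    have hK : ∀ h ∈ K, ∀ M ∈ V, ∑ j, M j j * h j = 0 := fun h hh M hM => by
      have := LinearMap.congr_fun (LinearMap.mem_ker.1 hh) ⟨δ ⟨M, hM⟩, ⟨_, rfl⟩⟩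
      simp only [Ψ, LinearMap.comp_apply, LinearMap.dualMap_apply, LinearEquiv.coe_coe,
        dotProductEquiv_apply_apply, Submodule.subtype_apply, dotProduct, hδ] at this
      rw [← LinearMap.zero_apply (σ₁₂ := RingHom.id ℝ) (⟨δ ⟨M, hM⟩, ⟨_, rfl⟩⟩ : LinearMap.range δ),
        ← this]
      exact Finset.sum_congr rfl fun j _ => mul_comm _ _
    have hKP : ∀ h ∈ K, ∀ i ∈ T, ∀ a b, P i a b ≠ 0 → h a = h b := fun h hh i hi =>
      (hcon h (by simpa using hK h hh 1 h1) (fun i hi => (hK h hh _ (hPi i hi)).ge) i hi).2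
    let D : (κ → ℝ) →ₗ[ℝ] Matrix κ κ ℝ := Matrix.diagonalLinearMap κ ℝ ℝ
    have hD : ∀ h, D h = diagonal h := fun h => rfl
    have hDinj : Function.Injective D := fun x y h => diagonal_injective h
    let S : Set (Matrix κ κ ℝ) := G ∪ D '' K
    have hsym : ∀ A ∈ S, Aᵀ = A := by
      rintro A ((rfl | ⟨i, hi, rfl⟩) | ⟨h, _, rfl⟩)
      · simp
      · exact (hP i hi).1
      · simp [hD]
    have hPD : ∀ i ∈ T, ∀ h ∈ K, P i * diagonal h = diagonal h * P i := fun i hi h hh => by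
      ext a b
      rw [diagonal_mul, mul_diagonal]
      by_cases h0 : P i a b = 0
      · simp [h0]
      · rw [hKP h hh i hi a b h0, mul_comm]
    have hPP : ∀ i ∈ T, ∀ j ∈ T, P i * P j = P j * P i := fun i hi j hj => by
      have e := fun h : P i * P j = P i => congrArg transpose h
      have e' := fun h : P i * P j = P j => congrArg transpose h
      simp only [transpose_mul, (hP i hi).1, (hP j hj).1] at e e'
      rcases hcomp i hi j hj with h | h
      · rw [h, e h]
      · rw [h, e' h]
    have hcomm : ∀ A ∈ S, ∀ B ∈ S, A * B = B * A := by
      rintro A ((rfl | ⟨i, hi, rfl⟩) | ⟨h, hh, rfl⟩) B ((rfl | ⟨j, hj, rfl⟩) | ⟨h', hh', rfl⟩)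
      all_goals try simp only [Matrix.one_mul, Matrix.mul_one]
      · exact hPP i hi j hj
      · exact hPD i hi h' hh'
      · exact (hPD j hj h hh).symm
      · simp only [hD, diagonal_mul_diagonal]
        congr 1; ext j; exact mul_comm _ _
    have hle := finrank_span_le_of_commute hsym hcomm
    have hspan : Submodule.span ℝ S = V ⊔ K.map D := by
      rw [Submodule.span_union, Submodule.span_image, Submodule.span_eq]
    have hdisj : V ⊓ K.map D = ⊥ := by
      rw [eq_bot_iff]
      rintro M ⟨hM, h, hh, rfl⟩
      have := hK h hh _ hM
      simp only [hD, diagonal_apply_eq] at this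
      have h0 : h = 0 := by
        ext j
        have := (Finset.sum_eq_zero_iff_of_nonneg (fun j _ => mul_self_nonneg (h j))).1 this j
          (Finset.mem_univ j)
        simpa using this
      simp [h0]
    have hsup := Submodule.finrank_sup_add_finrank_inf_eq V (K.map D)
    rw [← hspan, hdisj, finrank_bot, ← (K.equivMapOfInjective D hDinj).finrank_eq] at hsup
    have hrn := Ψ.finrank_range_add_finrank_ker
    have hrn' := δ.finrank_range_add_finrank_ker
    have hr := Submodule.finrank_le (LinearMap.range Ψ)
    rw [Subspace.dual_finrank_eq] at hr
    have hker : 0 < Module.finrank ℝ (LinearMap.ker δ) := by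
      rw [Nat.pos_iff_ne_zero, Ne, Submodule.finrank_eq_zero]; exact hinj
    rw [Module.finrank_fintype_fun_eq_card] at hrn
    change _ = _ + Module.finrank ℝ K at hsup
    change _ + Module.finrank ℝ K = _ at hrn
    omega

end Direction

section Gain

variable {ι κ : Type*} [Fintype κ] [DecidableEq κ]

lemma exists_gain {P : ι → Matrix κ κ ℝ} (T : Finset ι) (hP : ∀ i ∈ T, IsOrthProj (P i))
    (hcomp : ∀ i ∈ T, ∀ j ∈ T, P i * P j = P i ∨ P i * P j = P j)
    (htr : ∀ i ∈ T, 0 < (P i).trace ∧ (P i).trace < Fintype.card κ) {ρ : ℝ} (hρ : 0 < ρ) :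
    ∃ h : κ → ℝ, ∑ j, h j = 0 ∧ (∀ j, |h j| ≤ ρ) ∧
      ∀ i ∈ T, 1 < volFactor (P i) fun j => Real.exp (h j) := by
  classical
  induction T using Finset.strongInduction generalizing ρ with
  | H T ih =>
  rcases T.eq_empty_or_nonempty with rfl | hT
  · exact ⟨0, by simp, by simp [hρ.le], by simp⟩
  obtain ⟨h₀, hsum, hnn, i₀, hi₀, hstrict⟩ := exists_direction hT hP hcomp htr
  set t : ℝ := ρ / 2 / (1 + ∑ j, |h₀ j|) with ht
  have hden : 0 < 1 + ∑ j, |h₀ j| :=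
    add_pos_of_pos_of_nonneg one_pos (Finset.sum_nonneg fun j _ => abs_nonneg _)
  have htpos : 0 < t := by positivity
  set h₁ : κ → ℝ := fun j => t * h₀ j with hh₁
  have hb : ∀ j, |h₁ j| ≤ ρ / 2 := fun j => by
    rw [hh₁, abs_mul, abs_of_pos htpos, ht, div_mul_eq_mul_div, div_le_iff₀ hden]
    have := Finset.single_le_sum (fun j _ => abs_nonneg (h₀ j)) (Finset.mem_univ j)
    exact mul_le_mul_of_nonneg_left (by linarith) (by positivity)
  have hs1 : ∀ i, ∑ j, P i j j * h₁ j = t * ∑ j, P i j j * h₀ j := fun i => by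
    rw [Finset.mul_sum]
    exact Finset.sum_congr rfl fun j _ => by simp only [hh₁]; ring
  set T' := T.filter fun i => ∑ j, P i j j * h₁ j = 0 ∧ ∀ a b, P i a b ≠ 0 → h₁ a = h₁ b with hT'
  have hsub : T' ⊆ T := Finset.filter_subset _ _
  have hss : T' ⊂ T := by
    refine Finset.ssubset_iff_subset_ne.2 ⟨hsub, fun heq => ?_⟩
    rw [← heq, hT', Finset.mem_filter, hs1] at hi₀
    obtain ⟨-, h2, h3⟩ := hi₀
    rcases hstrict with h | h
    · exact (mul_pos htpos h).ne' h2
    · exact h fun a b hab => mul_left_cancel₀ htpos.ne' (h3 a b hab)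
  have hgain : ∀ i ∈ T, i ∉ T' → 1 < volFactor (P i) fun j => Real.exp (h₁ j) := by
    intro i hi hiT
    obtain ⟨h1, h2⟩ := volFactor_exp (hP i hi) h₁
    have h3 : 0 ≤ ∑ j, P i j j * h₁ j := by rw [hs1]; exact mul_nonneg htpos.le (hnn i hi)
    have h4 := Real.one_le_exp h3
    rcases h1.lt_or_eq with h | h
    · exact h4.trans_lt h
    · have h5 := h2 h
      rw [← h]
      refine lt_of_le_of_ne h4 fun h6 => hiT ?_
      rw [hT', Finset.mem_filter]
      exact ⟨hi, (Real.exp_eq_one_iff _).1 h6.symm, h5⟩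
  have hev : ∀ᶠ h' : κ → ℝ in 𝓝 0, ∀ i ∈ T \ T',
      1 < volFactor (P i) fun j => Real.exp (h₁ j + h' j) := by
    rw [Filter.eventually_all_finset]
    intro i hi
    rw [Finset.mem_sdiff] at hi
    have hc : Continuous fun h' : κ → ℝ => volFactor (P i) fun j => Real.exp (h₁ j + h' j) :=
      continuous_volFactor.comp (by fun_prop : Continuous fun h' : κ → ℝ =>
        (P i, fun j => Real.exp (h₁ j + h' j)))
    refine hc.continuousAt.eventually (lt_mem_nhds ?_)
    simpa using hgain i hi.1 hi.2
  obtain ⟨r, hr, hball⟩ := Metric.eventually_nhds_iff.1 hev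
  obtain ⟨h', hs', hb', hg'⟩ := ih T' hss (fun i hi => hP i (hsub hi))
    (fun i hi j hj => hcomp i (hsub hi) j (hsub hj)) (fun i hi => htr i (hsub hi))
    (ρ := min (ρ / 2) (r / 2)) (by positivity)
  refine ⟨fun j => h₁ j + h' j, ?_, fun j => ?_, fun i hi => ?_⟩
  · rw [Finset.sum_add_distrib, hs', ← Finset.mul_sum, hsum]; simp
  · calc |h₁ j + h' j| ≤ |h₁ j| + |h' j| := abs_add_le _ _
      _ ≤ ρ / 2 + ρ / 2 := add_le_add (hb j) ((hb' j).trans (min_le_left _ _))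
      _ = ρ := by ring
  · by_cases hiT : i ∈ T'
    · have hiT2 := hiT
      rw [hT', Finset.mem_filter] at hiT2
      simp only [Real.exp_add]
      rw [volFactor_mul (hP i hi) (fun a b hab => by rw [hiT2.2.2 a b hab]),
        volFactor_exp_eq_one (hP i hi) hiT2.2.2 hiT2.2.1, one_mul]
      exact hg' i hiT
    · refine hball ?_ i (by simp [hi, hiT])
      refine ((dist_pi_le_iff (by positivity : (0 : ℝ) ≤ r / 2)).2 fun j => ?_).trans_lt
        (half_lt_self hr)
      simpa using (hb' j).trans (min_le_right _ _)

lemma IsOrthProj.abs_apply_le_one {P : Matrix κ κ ℝ} (hP : IsOrthProj P) (a b : κ) :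
    |P a b| ≤ 1 := by
  have h : P b b = ∑ i, P i b ^ 2 := by
    conv_lhs => rw [← hP.2]
    refine Finset.sum_congr rfl fun i _ => ?_
    have := congrFun (congrFun hP.1 i) b
    rw [transpose_apply] at this
    simp only [this, sq]
  have h1 := Finset.single_le_sum (fun i _ => sq_nonneg (P i b)) (Finset.mem_univ a)
  have h2 := hP.diag_le_one b
  rw [← sq_le_one_iff_abs_le_one]
  linarith

/-- Families of pairwise comparable orthogonal projections onto proper nonzero subspaces. -/
def flagProjs (ι κ : Type*) [Fintype κ] : Set (ι → Matrix κ κ ℝ) :=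
  {P | (∀ i, IsOrthProj (P i)) ∧ (∀ i j, P i * P j = P i ∨ P i * P j = P j) ∧
    ∀ i, 1 ≤ (P i).trace ∧ (P i).trace ≤ Fintype.card κ - 1}

lemma isCompact_flagProjs : IsCompact (flagProjs ι κ) := by
  have hc : IsCompact (Set.pi Set.univ fun _ : ι => Set.pi Set.univ fun _ : κ =>
      Set.pi Set.univ fun _ : κ => Set.Icc (-1 : ℝ) 1) :=
    isCompact_univ_pi fun _ => isCompact_univ_pi fun _ => isCompact_univ_pi fun _ =>
      isCompact_Icc
  refine IsCompact.of_isClosed_subset hc ?_ fun P hP i _ a _ b _ =>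
    abs_le.1 ((hP.1 i).abs_apply_le_one a b)
  have hcont : ∀ i, Continuous fun P : ι → Matrix κ κ ℝ => P i := fun i => continuous_apply i
  simp only [flagProjs, IsOrthProj, Set.ofPred_and, Set.ofPred_forall, Set.ofPred_or]
  refine IsClosed.inter ?_ (IsClosed.inter ?_ ?_)
  · exact isClosed_iInter fun i => IsClosed.inter
      (isClosed_eq (hcont i).matrix_transpose (hcont i))
      (isClosed_eq ((hcont i).matrix_mul (hcont i)) (hcont i))
  · exact isClosed_iInter fun i => isClosed_iInter fun j => IsClosed.union
      (isClosed_eq ((hcont i).matrix_mul (hcont j)) (hcont i))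
      (isClosed_eq ((hcont i).matrix_mul (hcont j)) (hcont j))
  · exact isClosed_iInter fun i => IsClosed.inter
      (isClosed_le continuous_const (hcont i).matrix_trace)
      (isClosed_le (hcont i).matrix_trace continuous_const)

lemma exists_uniform_gain [Fintype ι] {ρ : ℝ} (hρ : 0 < ρ) :
    ∃ γ : ℝ, 1 < γ ∧ ∀ P ∈ flagProjs ι κ, ∃ h : κ → ℝ, ∑ j, h j = 0 ∧ (∀ j, |h j| ≤ ρ) ∧
      ∀ i, γ ≤ volFactor (P i) fun j => Real.exp (h j) := by
  let U : ℕ → Set (ι → Matrix κ κ ℝ) := fun m => ⋃ h ∈ {h : κ → ℝ | ∑ j, h j = 0 ∧ ∀ j, |h j| ≤ ρ},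
    ⋂ i, {P | 1 + 1 / ((m : ℝ) + 1) < volFactor (P i) fun j => Real.exp (h j)}
  have hU : ∀ m, IsOpen (U m) := fun m => isOpen_biUnion fun h _ => isOpen_iInter_of_finite fun i =>
    isOpen_lt continuous_const (continuous_volFactor.comp
      (f := fun P : ι → Matrix κ κ ℝ => (P i, fun j => Real.exp (h j)))
      ((continuous_apply i).prodMk continuous_const))
  have hmono : Monotone U := fun m m' hm P hPm => by
    simp only [U, Set.mem_iUnion, Set.mem_iInter, Set.mem_ofPred_eq, exists_prop] at hPm ⊢
    obtain ⟨h, h1, h2⟩ := hPm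
    refine ⟨h, h1, fun i => lt_of_le_of_lt ?_ (h2 i)⟩
    have := Nat.one_div_le_one_div (α := ℝ) hm
    linarith
  have hcov : flagProjs ι κ ⊆ ⋃ m, U m := fun P hP => by
    obtain ⟨h, h1, h2, h3⟩ := exists_gain (P := P) Finset.univ (fun i _ => hP.1 i)
      (fun i _ j _ => hP.2.1 i j) (fun i _ => ⟨by linarith [(hP.2.2 i).1],
        by linarith [(hP.2.2 i).2]⟩)
      hρ
    have hev : ∀ᶠ m : ℕ in atTop, ∀ i, 1 + 1 / ((m : ℝ) + 1) <
        volFactor (P i) fun j => Real.exp (h j) := by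
      rw [Filter.eventually_all]
      intro i
      have := (tendsto_one_div_add_atTop_nhds_zero_nat (𝕜 := ℝ)).const_add 1
      rw [add_zero] at this
      exact this.eventually (gt_mem_nhds (h3 i (Finset.mem_univ i)))
    obtain ⟨m, hm⟩ := hev.exists
    simp only [U, Set.mem_iUnion, Set.mem_iInter, Set.mem_ofPred_eq, exists_prop]
    exact ⟨m, h, ⟨h1, h2⟩, hm⟩
  obtain ⟨m, hm⟩ := isCompact_flagProjs.elim_directed_cover U hU hcov hmono.directed_le
  refine ⟨1 + 1 / ((m : ℝ) + 1), by simp; positivity, fun P hP => ?_⟩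
  have := hm hP
  simp only [U, Set.mem_iUnion, Set.mem_iInter, Set.mem_ofPred_eq, exists_prop] at this
  obtain ⟨h, ⟨h1, h2⟩, h3⟩ := this
  exact ⟨h, h1, h2, fun i => (h3 i).le⟩

end Gain

section IntModule

variable {M : Type*} [AddCommGroup M]

lemma exists_complement_of_saturated [Module.IsTorsionFree ℤ M] {N N₀ : Submodule ℤ M}
    (hfg : N.FG) (hle : N₀ ≤ N)
    (hsat : ∀ k : ℤ, k ≠ 0 → ∀ m ∈ N, k • m ∈ N₀ → m ∈ N₀) {ι : Type*} {z : ι → M}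
    (hz : LinearIndependent ℤ z) (hzN : Submodule.span ℤ (Set.range z) = N₀) :
    ∃ (a : ℕ) (p : Fin a → M), LinearIndependent ℤ (Sum.elim z p) ∧
      Submodule.span ℤ (Set.range (Sum.elim z p)) = N := by
  subst hzN
  set N₀ := Submodule.span ℤ (Set.range z) with hN₀
  let W : Submodule ℤ N := N₀.comap N.subtype
  let bW : Module.Basis ι ℤ W :=
    (Module.Basis.span hz).map (Submodule.comapSubtypeEquivOfLe hle).symm
  have : Module.Finite ℤ N := Module.Finite.iff_fg.2 hfg
  have : Module.IsTorsionFree ℤ (N ⧸ W) := by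
    refine ⟨fun k hk => ?_⟩
    rw [isRegular_iff_ne_zero] at hk
    intro x y hxy
    obtain ⟨x, rfl⟩ := W.mkQ_surjective x
    obtain ⟨y, rfl⟩ := W.mkQ_surjective y
    simp only [← map_smul, ← sub_eq_zero (a := W.mkQ (k • x)), ← map_sub, ← smul_sub] at hxy
    rw [← sub_eq_zero, ← map_sub]
    rw [Submodule.mkQ_apply, Submodule.Quotient.mk_eq_zero] at hxy ⊢
    exact hsat k hk _ (x - y).2 hxy
  let bQ := Module.finBasis ℤ (N ⧸ W)
  let B := Module.Basis.sumQuot bW bQ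
  let p : Fin _ → M := fun j => (B (Sum.inr j) : M)
  have hB : Sum.elim z p = N.subtype ∘ B := by
    ext (i | j)
    · simp [B, Module.Basis.sumQuot_inl, bW, Module.Basis.span_apply]
      rfl
    · rfl
  refine ⟨_, p, ?_, ?_⟩
  · rw [hB]
    exact B.linearIndependent.map' _ N.ker_subtype
  · rw [hB, Set.range_comp, Submodule.span_image, B.span_eq, Submodule.map_top,
      Submodule.range_subtype]

lemma exists_adapted_bases [Module.IsTorsionFree ℤ M] {N₁ N₂ : Submodule ℤ M}
    (h₁ : N₁.FG) (h₂ : N₂.FG)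
    (hs₁ : ∀ k : ℤ, k ≠ 0 → ∀ m ∈ N₁, k • m ∈ N₂ → m ∈ N₂)
    (hs₂ : ∀ k : ℤ, k ≠ 0 → ∀ m ∈ N₂, k • m ∈ N₁ → m ∈ N₁) :
    ∃ (t a b : ℕ) (z : Fin t → M) (p : Fin a → M) (q : Fin b → M),
      LinearIndependent ℤ (Sum.elim z (Sum.elim p q)) ∧
      Submodule.span ℤ (Set.range z) = N₁ ⊓ N₂ ∧
      Submodule.span ℤ (Set.range (Sum.elim z p)) = N₁ ∧
      Submodule.span ℤ (Set.range (Sum.elim z q)) = N₂ := by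
  have : Module.Finite ℤ (N₁ ⊓ N₂ : Submodule ℤ M) := Module.Finite.iff_fg.2 (h₁.of_le inf_le_left)
  let bz := Module.finBasis ℤ (N₁ ⊓ N₂ : Submodule ℤ M)
  let z : Fin _ → M := fun i => (bz i : M)
  have hz : LinearIndependent ℤ z := bz.linearIndependent.map' _ (N₁ ⊓ N₂).ker_subtype
  have hzs : Submodule.span ℤ (Set.range z) = N₁ ⊓ N₂ := by
    have : z = (N₁ ⊓ N₂).subtype ∘ bz := rfl
    rw [this, Set.range_comp, Submodule.span_image, bz.span_eq, Submodule.map_top,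
      Submodule.range_subtype]
  obtain ⟨a, p, hp, hps⟩ := exists_complement_of_saturated h₁ inf_le_left
    (fun k hk m hm hkm => ⟨hm, hs₁ k hk m hm hkm.2⟩) hz hzs
  obtain ⟨b, q, hq, hqs⟩ := exists_complement_of_saturated h₂ inf_le_right
    (fun k hk m hm hkm => ⟨hs₂ k hk m hm hkm.1, hm⟩) hz hzs
  refine ⟨_, a, b, z, p, q, ?_, hzs, hps, hqs⟩
  have hq' := linearIndependent_sum.1 hq
  simp only [Sum.elim_comp_inl, Sum.elim_comp_inr] at hq'
  have hdis : Disjoint (Submodule.span ℤ (Set.range (Sum.elim z p)))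
      (Submodule.span ℤ (Set.range q)) := by
    rw [hps, Submodule.disjoint_def]
    intro m hm1 hm2
    have hm3 : m ∈ N₂ := by
      rw [← hqs]
      exact Submodule.span_mono (by rintro _ ⟨j, rfl⟩; exact ⟨Sum.inr j, rfl⟩) hm2
    refine (Submodule.disjoint_def.1 hq'.2.2) m ?_ hm2
    rw [hzs]; exact ⟨hm1, hm3⟩
  have h3 : LinearIndependent ℤ (Sum.elim (Sum.elim z p) q) := hp.sum_type hq'.2.1 hdis
  have := h3.comp _ (Equiv.sumAssoc _ _ _).symm.injective
  convert! this using 1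
  ext (i | i | i) <;> rfl

end IntModule

section Lattice

variable {n : ℕ}

/-- A lattice with a basis of covolume at least one. -/
def HasLargeBasis (x : AddSubgroup (Fin n → ℝ)) : Prop :=
  ∃ b : Matrix (Fin n) (Fin n) ℝ, 1 ≤ gramDet b ∧ x = AddSubgroup.closure (Set.range b.row)

lemma linearIndependent_of_gramDet_ne_zero {b : Matrix (Fin n) (Fin n) ℝ} (hb : gramDet b ≠ 0) :
    LinearIndependent ℝ b.row := by
  rw [gramDet, det_mul] at hb
  exact Matrix.linearIndependent_rows_iff_isUnit.2
    ((Matrix.isUnit_iff_isUnit_det _).2 (isUnit_iff_ne_zero.2 (left_ne_zero_of_mul hb)))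

lemma toIntSubmodule_closure (s : Set (Fin n → ℝ)) :
    AddSubgroup.toIntSubmodule (AddSubgroup.closure s) = Submodule.span ℤ s := by
  rw [AddSubgroup.toIntSubmodule_closure]

lemma HasLargeBasis.discreteTopology {x : AddSubgroup (Fin n → ℝ)} (hx : HasLargeBasis x) :
    DiscreteTopology (AddSubgroup.toIntSubmodule x) := by
  obtain ⟨b, hb, rfl⟩ := hx
  have hb' : LinearIndependent ℝ b.row := linearIndependent_of_gramDet_ne_zero (by linarith)
  rw [toIntSubmodule_closure]
  let B := basisOfLinearIndependentOfCardEqFinrank' b.row hb' (by simp)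
  have : (B : Fin n → Fin n → ℝ) = b.row := coe_basisOfLinearIndependentOfCardEqFinrank' _ _ _
  rw [← this]
  infer_instance

lemma discreteTopology_of_le {X Y : Submodule ℤ (Fin n → ℝ)} [DiscreteTopology X] (h : Y ≤ X) :
    DiscreteTopology Y :=
  DiscreteTopology.of_subset (s := (X : Set (Fin n → ℝ))) inferInstance h

lemma linearIndependent_real_of_int {X : Submodule ℤ (Fin n → ℝ)} [DiscreteTopology X] {ι : Type*}
    [Fintype ι] {y : ι → Fin n → ℝ} (hy : LinearIndependent ℤ y) (hX : ∀ i, y i ∈ X) :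
    LinearIndependent ℝ y := by
  have hd : DiscreteTopology (Submodule.span ℤ (Set.range y)) :=
    discreteTopology_of_le (X := X) (Submodule.span_le.2 (by rintro _ ⟨i, rfl⟩; exact hX i))
  rw [linearIndependent_iff_card_eq_finrank_span, Real.finrank_eq_int_finrank_of_discrete hd]
  exact (finrank_span_eq_card hy).symm

lemma gramDet_le_of_mem_span {ι ι' κ : Type*} [Fintype ι] [DecidableEq ι] [Fintype ι']
    [DecidableEq ι'] [Fintype κ] {v : Matrix ι κ ℝ} {y : Matrix ι' κ ℝ}
    (hv : LinearIndependent ℝ v.row) (hc : Fintype.card ι = Fintype.card ι')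
    (h : ∀ i, v i ∈ Submodule.span ℤ (Set.range y.row)) : gramDet y ≤ gramDet v := by
  let e := Fintype.equivOfCardEq hc
  have h' : ∀ i, ∃ c : ι → ℤ, v i = ∑ j, c j • y (e j) := fun i => by
    obtain ⟨c, hc⟩ := (Submodule.mem_span_range_iff_exists_fun ℤ).1 (h i)
    refine ⟨c ∘ e, ?_⟩
    rw [← hc, ← e.sum_comp]; rfl
  choose C hC using h'
  have hM : v = (Matrix.of C).map (Int.cast : ℤ → ℝ) * y.submatrix e id := by
    ext i k
    rw [hC, Matrix.mul_apply]
    simp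
  have hpos := gramDet_pos hv
  rw [← gramDet_reindex e y]
  rw [hM, gramDet_mul] at hpos ⊢
  have hdet : ((Matrix.of C).map (Int.cast : ℤ → ℝ)).det = ((Matrix.of C).det : ℝ) :=
    (Int.cast_det _).symm
  rw [hdet] at hpos ⊢
  have h0 : (Matrix.of C).det ≠ 0 := by
    intro h0
    simp [h0] at hpos
  have h1 : (1 : ℝ) ≤ ((Matrix.of C).det : ℝ) ^ 2 := by
    exact_mod_cast (one_le_sq_iff_one_le_abs _).2 (Int.one_le_abs h0)
  exact le_mul_of_one_le_left (gramDet_nonneg _) h1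

end Lattice

section Families

variable {n : ℕ}

lemma card_le_of_mem_span {ι ι' V : Type*} [Fintype ι] [Fintype ι'] [AddCommGroup V] [Module ℝ V]
    [FiniteDimensional ℝ V] {f : ι → V} {g : ι' → V}
    (hf : LinearIndependent ℝ f) (h : ∀ i, f i ∈ Submodule.span ℝ (Set.range g)) :
    Fintype.card ι ≤ Fintype.card ι' := by
  rw [← finrank_span_eq_card hf]
  exact (Submodule.finrank_mono (Submodule.span_le.2 (by rintro _ ⟨i, rfl⟩; exact h i))).trans
    (finrank_range_le_card g)

/-- The lattice generated by the rows of `v` and the one generated by the rows of `w` may be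
replaced by their saturated sum and intersection. -/
lemma exists_inf_sup {x : AddSubgroup (Fin n → ℝ)} (hx : HasLargeBasis x) {r q : ℕ}
    {v : Matrix (Fin r) (Fin n) ℝ} {w : Matrix (Fin q) (Fin n) ℝ}
    (hv : LinearIndependent ℝ v.row) (hw : LinearIndependent ℝ w.row)
    (hvx : ∀ i, v i ∈ x) (hwx : ∀ i, w i ∈ x) :
    ∃ (t a b : ℕ) (z : Matrix (Fin t) (Fin n) ℝ) (u : Matrix (Fin t ⊕ (Fin a ⊕ Fin b)) (Fin n) ℝ),
      r = t + a ∧ q = t + b ∧ LinearIndependent ℝ z.row ∧ LinearIndependent ℝ u.row ∧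
      (∀ i, z i ∈ x) ∧ (∀ i, u i ∈ x) ∧ gramDet u * gramDet z ≤ gramDet v * gramDet w ∧
      (a = 0 → ∀ i, v i ∈ Submodule.span ℝ (Set.range w.row)) ∧
      (b = 0 → ∀ i, w i ∈ Submodule.span ℝ (Set.range v.row)) := by
  have hdisc := hx.discreteTopology
  set X := AddSubgroup.toIntSubmodule x with hX
  have hXfg : X.FG := by
    obtain ⟨b, -, hb⟩ := hx
    rw [hX, hb, toIntSubmodule_closure]
    exact Submodule.fg_span (Set.finite_range _)
  set V := Submodule.span ℝ (Set.range v.row) with hV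
  set W := Submodule.span ℝ (Set.range w.row) with hW
  set N₁ := X ⊓ V.restrictScalars ℤ with hN₁
  set N₂ := X ⊓ W.restrictScalars ℤ with hN₂
  have hsat : ∀ (U : Submodule ℝ (Fin n → ℝ)) (k : ℤ), k ≠ 0 → ∀ m, k • m ∈ U → m ∈ U := by
    intro U k hk m hm
    rw [← Int.cast_smul_eq_zsmul ℝ] at hm
    exact (U.smul_mem_iff (Int.cast_ne_zero.2 hk)).1 hm
  obtain ⟨t, a, b, z, p, y, hli, hz, hzp, hzy⟩ := exists_adapted_bases (N₁ := N₁) (N₂ := N₂)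
    (hXfg.of_le inf_le_left) (hXfg.of_le inf_le_left)
    (fun k hk m hm hkm => ⟨hm.1, hsat W k hk m hkm.2⟩)
    (fun k hk m hm hkm => ⟨hm.1, hsat V k hk m hkm.2⟩)
  have mz : ∀ i, z i ∈ N₁ ⊓ N₂ := fun i => hz ▸ Submodule.subset_span ⟨i, rfl⟩
  have mzp : ∀ i, Sum.elim z p i ∈ N₁ := fun i => hzp ▸ Submodule.subset_span ⟨i, rfl⟩
  have mzy : ∀ i, Sum.elim z y i ∈ N₂ := fun i => hzy ▸ Submodule.subset_span ⟨i, rfl⟩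
  have mu : ∀ i, Sum.elim z (Sum.elim p y) i ∈ X := by
    rintro (i | i | i)
    · exact (mz i).1.1
    · exact (mzp (Sum.inr i)).1
    · exact (mzy (Sum.inr i)).1
  have hliR := linearIndependent_real_of_int hli mu
  have hzR : LinearIndependent ℝ z := hliR.comp Sum.inl Sum.inl_injective
  have hzpR : LinearIndependent ℝ (Sum.elim z p) := by
    convert! hliR.comp (Sum.map id Sum.inl)
      (Sum.map_injective.2 ⟨Function.injective_id, Sum.inl_injective⟩) using 1
    ext (i | i) <;> rfl
  have hzyR : LinearIndependent ℝ (Sum.elim z y) := by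
    convert! hliR.comp (Sum.map id Sum.inr)
      (Sum.map_injective.2 ⟨Function.injective_id, Sum.inr_injective⟩) using 1
    ext (i | i) <;> rfl
  have hvN : ∀ i, v i ∈ Submodule.span ℤ (Set.range (Sum.elim z p)) := fun i => by
    rw [hzp]; exact ⟨hvx i, Submodule.subset_span ⟨i, rfl⟩⟩
  have hwN : ∀ i, w i ∈ Submodule.span ℤ (Set.range (Sum.elim z y)) := fun i => by
    rw [hzy]; exact ⟨hwx i, Submodule.subset_span ⟨i, rfl⟩⟩
  have hr : r = t + a := by
    have h1 := card_le_of_mem_span hv fun i => Submodule.span_le_restrictScalars ℤ ℝ _ (hvN i)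
    have h2 := card_le_of_mem_span hzpR fun i => (mzp i).2
    simp only [Fintype.card_sum, Fintype.card_fin] at h1 h2
    omega
  have hq : q = t + b := by
    have h1 := card_le_of_mem_span hw fun i => Submodule.span_le_restrictScalars ℤ ℝ _ (hwN i)
    have h2 := card_le_of_mem_span hzyR fun i => (mzy i).2
    simp only [Fintype.card_sum, Fintype.card_fin] at h1 h2
    omega
  refine ⟨t, a, b, z, fromRows z (fromRows p y), hr, hq, hzR, hliR, fun i => (mz i).1.1, mu,
    ?_, ?_, ?_⟩
  · have g1 : gramDet (fromRows z p) ≠ 0 := (gramDet_pos (v := fromRows z p) hzpR).ne'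
    have g2 : gramDet (κ := Fin n) z ≠ 0 := (gramDet_pos (v := z) hzR).ne'
    refine (gramDet_submodular y g1 g2).trans
      (mul_le_mul ?_ ?_ (gramDet_nonneg _) (gramDet_nonneg _))
    · exact gramDet_le_of_mem_span hv (by simp [hr]) hvN
    · exact gramDet_le_of_mem_span hw (by simp [hq]) hwN
  · rintro rfl i
    have h1 : v i ∈ N₁ ⊓ N₂ := by
      rw [← hz]
      have := hvN i
      rwa [Set.Sum.elim_range, Set.range_eq_empty p, Set.union_empty] at this
    exact h1.2.2
  · rintro rfl i
    have h1 : w i ∈ N₁ ⊓ N₂ := by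
      rw [← hz]
      have := hwN i
      rwa [Set.Sum.elim_range, Set.range_eq_empty y, Set.union_empty] at this
    exact h1.1.2

lemma HasLargeBasis.one_le_gramDet {x : AddSubgroup (Fin n → ℝ)} (hx : HasLargeBasis x)
    {ι : Type*} [Fintype ι] [DecidableEq ι] (hι : Fintype.card ι = n)
    {v : Matrix ι (Fin n) ℝ} (hv : LinearIndependent ℝ v.row) (hvx : ∀ i, v i ∈ x) :
    1 ≤ gramDet v := by
  obtain ⟨b, hb, rfl⟩ := hx
  refine hb.trans (gramDet_le_of_mem_span hv (by simp [hι]) fun i => ?_)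
  rw [← toIntSubmodule_closure]
  exact hvx i

lemma HasLargeBasis.exists_pos_le_gramDet {x : AddSubgroup (Fin n → ℝ)} (hx : HasLargeBasis x) :
    ∃ c : ℝ, 0 < c ∧ ∀ (ι : Type) [Fintype ι] [DecidableEq ι] (v : Matrix ι (Fin n) ℝ),
      LinearIndependent ℝ v.row → (∀ i, v i ∈ x) → c ≤ gramDet v := by
  suffices ∀ m : ℕ, ∃ c : ℝ, 0 < c ∧ ∀ (ι : Type) [Fintype ι] [DecidableEq ι]
      (v : Matrix ι (Fin n) ℝ), n ≤ Fintype.card ι + m →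
      LinearIndependent ℝ v.row → (∀ i, v i ∈ x) → c ≤ gramDet v by
    obtain ⟨c, hc, h⟩ := this n
    exact ⟨c, hc, fun ι _ _ v hv hvx => h ι v (by omega) hv hvx⟩
  obtain ⟨b, hb, hbx⟩ := id hx
  have hb' : LinearIndependent ℝ b.row := linearIndependent_of_gramDet_ne_zero (by linarith)
  have hbm : ∀ j, b j ∈ x := fun j => hbx ▸ AddSubgroup.subset_closure ⟨j, rfl⟩
  intro m
  induction m with
  | zero =>
    refine ⟨1, one_pos, fun ι _ _ v hn hv hvx =>
      hx.one_le_gramDet (le_antisymm ?_ (by simpa using hn)) hv hvx⟩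
    simpa using hv.fintype_card_le_finrank
  | succ m ih =>
    obtain ⟨c, hc, ih⟩ := ih
    let R : Fin n → Matrix Unit (Fin n) ℝ := fun j => Matrix.of fun _ => b j
    have hR : 0 ≤ ∑ j, gramDet (R j) := Finset.sum_nonneg fun j _ => gramDet_nonneg _
    refine ⟨min c (c / (1 + ∑ j, gramDet (R j))), by positivity, fun ι _ _ v hn hv hvx => ?_⟩
    by_cases hn' : n ≤ Fintype.card ι + m
    · exact (min_le_left _ _).trans (ih ι v hn' hv hvx)
    refine (min_le_right _ _).trans ?_
    obtain ⟨j, hj⟩ : ∃ j, b j ∉ Submodule.span ℝ (Set.range v.row) := by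
      by_contra! h
      have := card_le_of_mem_span hb' h
      simp at this
      omega
    have hR0 : LinearIndependent ℝ (R j).row := by
      rw [linearIndependent_unique_iff]
      exact hb'.ne_zero j
    have hli : LinearIndependent ℝ (fromRows v (R j)).row := by
      refine hv.sum_type hR0 ?_
      have : Set.range (R j).row = {b j} := by
        ext y
        simp only [Set.mem_range, Set.mem_singleton_iff]
        exact ⟨fun ⟨_, h⟩ => h.symm, fun h => ⟨(), h.symm⟩⟩
      have hd := Submodule.disjoint_span_singleton_of_notMem hj
      rwa [← this] at hd
    have h1 := ih _ (fromRows v (R j)) (by simp; omega) hli (by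
      rintro (i | i)
      · exact hvx i
      · exact hbm j)
    have h2 := gramDet_fromRows_le (gramDet_pos hv).ne' (R j)
    have h3 := Finset.single_le_sum (fun j _ => gramDet_nonneg (R j)) (Finset.mem_univ j)
    rw [div_le_iff₀ (by linarith)]
    refine h1.trans (h2.trans (mul_le_mul_of_nonneg_left ?_ (gramDet_nonneg v)))
    linarith

lemma mul_rowProj_of_mem_span {ι ι' κ : Type*} [Fintype ι] [Fintype ι'] [DecidableEq ι'] [Fintype κ]
    {v : Matrix ι κ ℝ} {w : Matrix ι' κ ℝ} (hw : gramDet w ≠ 0)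
    (h : ∀ i, v i ∈ Submodule.span ℝ (Set.range w.row)) : v * rowProj w = v := by
  choose C hC using fun i => (Submodule.mem_span_range_iff_exists_fun ℝ).1 (h i)
  have : v = Matrix.of C * w := by
    ext i k
    rw [← hC, Matrix.mul_apply]
    simp
  rw [this, Matrix.mul_assoc, mul_rowProj hw]

end Families

section Weights

variable {n : ℕ}

lemma mulVec_row_diagonal {ι : Type*} (v : Matrix ι (Fin n) ℝ) (d : Fin n → ℝ) (i : ι) :
    diagonal d *ᵥ (v i) = (v * diagonal d) i := by
  ext j
  rw [mulVec_diagonal, mul_diagonal, mul_comm]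

lemma mapLat_closure (b : Matrix (Fin n) (Fin n) ℝ) (d : Fin n → ℝ) :
    mapLat (diagonal d) (AddSubgroup.closure (Set.range b.row)) =
      AddSubgroup.closure (Set.range (b * diagonal d).row) := by
  rw [mapLat, AddMonoidHom.map_closure, ← Set.range_comp]
  congr 2
  ext1 i
  exact mulVec_row_diagonal b d i

lemma mapLat_mul (g g' : Matrix (Fin n) (Fin n) ℝ) (x : AddSubgroup (Fin n → ℝ)) :
    mapLat g (mapLat g' x) = mapLat (g * g') x := by
  rw [mapLat, mapLat, mapLat, AddSubgroup.map_map]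
  rw [Matrix.mulVecLin_mul]
  rfl

lemma mapLat_one (x : AddSubgroup (Fin n → ℝ)) : mapLat 1 x = x := by
  ext v
  simp [mapLat]

lemma HasLargeBasis.map_diagonal {x : AddSubgroup (Fin n → ℝ)} (hx : HasLargeBasis x)
    {d : Fin n → ℝ} (hd : ∏ i, d i = 1) : HasLargeBasis (mapLat (diagonal d) x) := by
  obtain ⟨b, hb, rfl⟩ := hx
  refine ⟨b * diagonal d, ?_, mapLat_closure b d⟩
  rw [gramDet, det_mul, det_transpose] at hb ⊢
  rwa [det_mul, det_diagonal, hd, mul_one]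

lemma exists_eq_mul_diagonal {x : AddSubgroup (Fin n → ℝ)} {d : Fin n → ℝ} {ι : Type*}
    {v : Matrix ι (Fin n) ℝ} (hv : LinearIndependent ℝ v.row)
    (hvx : ∀ i, v i ∈ SW.mapLat (diagonal d) x) :
    ∃ w : Matrix ι (Fin n) ℝ, LinearIndependent ℝ w.row ∧ (∀ i, w i ∈ x) ∧ v = w * diagonal d := by
  choose w hwx hw using hvx
  have h : v = Matrix.of w * diagonal d := by
    ext1 i
    rw [← mulVec_row_diagonal, ← hw]
    exact fun _ => rfl
  refine ⟨Matrix.of w, ?_, hwx, h⟩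
  refine LinearIndependent.of_comp (Matrix.mulVecLin (diagonal d)) ?_
  convert hv using 1
  ext1 i
  exact hw i

/-- A lower bound for the squared covolumes of the subgroups of `x`, twisted by the strictly
concave weight `E ^ (r (n - r))` in rank `r`. -/
def WeightBound (E c : ℝ) (x : AddSubgroup (Fin n → ℝ)) : Prop :=
  ∀ (ι : Type) [Fintype ι] [DecidableEq ι] (v : Matrix ι (Fin n) ℝ),
    LinearIndependent ℝ v.row → (∀ i, v i ∈ x) →
      c ≤ gramDet v * E ^ (Fintype.card ι * (n - Fintype.card ι))

/-- The families whose twisted squared covolume is within a factor `E` of the bound `c`. -/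
structure IsNear (E c : ℝ) (x : AddSubgroup (Fin n → ℝ)) {r : ℕ} (v : Matrix (Fin r) (Fin n) ℝ) :
    Prop where
  pos : 0 < r
  lt : r < n
  li : LinearIndependent ℝ v.row
  mem : ∀ i, v i ∈ x
  near : gramDet v * E ^ (r * (n - r)) < E * c

lemma WeightBound.comparable {E c : ℝ} {x : AddSubgroup (Fin n → ℝ)} (hW : WeightBound E c x)
    (hE : 1 < E) (hc : 0 < c) (hx : HasLargeBasis x) {r q : ℕ} {v : Matrix (Fin r) (Fin n) ℝ}
    {w : Matrix (Fin q) (Fin n) ℝ} (hv : IsNear E c x v) (hw : IsNear E c x w) :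
    (rowProj v * rowProj w = rowProj v ∨ rowProj v * rowProj w = rowProj w) ∧
      (r = q → rowProj v = rowProj w) := by
  obtain ⟨t, a, b, z, u, hr, hq, hz, hu, hzx, hux, hle, ha, hb⟩ :=
    exists_inf_sup hx hv.li hw.li hv.mem hw.mem
  have h1 : a = 0 → rowProj v * rowProj w = rowProj v := fun h =>
    rowProj_mul_of_mul (mul_rowProj_of_mem_span (gramDet_pos hw.li).ne' (ha h))
  have h2 : b = 0 → rowProj v * rowProj w = rowProj w := fun h => by
    have := rowProj_mul_of_mul (mul_rowProj_of_mem_span (gramDet_pos hv.li).ne' (hb h))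
    have := congrArg transpose this
    rwa [transpose_mul, rowProj_transpose, rowProj_transpose] at this
  have h3 : a = 0 ∨ b = 0 := by
    by_contra! hab
    have hs : t + (a + b) ≤ n := by simpa using hu.fintype_card_le_finrank
    obtain ⟨m, hm⟩ := Nat.exists_eq_add_of_le hs
    have hcu := hW _ u hu hux
    have hcz := hW _ z hz hzx
    have hv1 := hv.near
    have hw1 := hw.near
    have e1 : r * (n - r) = (t + a) * (b + m) := by
      rw [show n - r = b + m by omega, hr]
    have e2 : q * (n - q) = (t + b) * (a + m) := by
      rw [show n - q = a + m by omega, hq]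
    have e3 : (t + (a + b)) * (n - (t + (a + b))) = (t + (a + b)) * m := by
      rw [show n - (t + (a + b)) = m by omega]
    have e4 : t * (n - t) = t * (a + b + m) := by
      rw [show n - t = a + b + m by omega]
    simp only [Fintype.card_sum, Fintype.card_fin, e3, e4] at hcu hcz
    rw [e1] at hv1
    rw [e2] at hw1
    have hE0 : 0 < E := by linarith
    have hab1 : 1 ≤ a * b := Nat.mul_pos (by omega) (by omega)
    have k1 : c * c ≤ gramDet v * gramDet w * E ^ ((t + (a + b)) * m + t * (a + b + m)) := by
      calc c * c ≤ (gramDet u * E ^ ((t + (a + b)) * m)) * (gramDet z * E ^ (t * (a + b + m))) :=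
            mul_le_mul hcu hcz hc.le (hc.le.trans hcu)
        _ = gramDet u * gramDet z * E ^ ((t + (a + b)) * m + t * (a + b + m)) := by
            rw [pow_add]; ring
        _ ≤ _ := by gcongr
    have k2 : (gramDet v * E ^ ((t + a) * (b + m))) * (gramDet w * E ^ ((t + b) * (a + m)))
        < (E * c) * (E * c) :=
      mul_lt_mul'' hv1 hw1 (mul_nonneg (gramDet_nonneg v) (by positivity))
        (mul_nonneg (gramDet_nonneg w) (by positivity))
    have k3 : (gramDet v * E ^ ((t + a) * (b + m))) * (gramDet w * E ^ ((t + b) * (a + m)))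
        = gramDet v * gramDet w * E ^ ((t + (a + b)) * m + t * (a + b + m)) *
          E ^ (2 * (a * b)) := by
      rw [mul_assoc _ (E ^ _) (E ^ _), ← pow_add, mul_mul_mul_comm, ← pow_add]
      ring_nf
    have k4 : c * c * E ^ 2 ≤
        gramDet v * gramDet w * E ^ ((t + (a + b)) * m + t * (a + b + m)) * E ^ (2 * (a * b)) :=
      mul_le_mul k1 (pow_le_pow_right₀ hE.le (by omega)) (by positivity)
        ((mul_pos hc hc).le.trans k1)
    nlinarith
  refine ⟨h3.imp h1 h2, fun hrq => ?_⟩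
  rw [← h1 (by omega), h2 (by omega)]

lemma IsNear.trace {E c : ℝ} {x : AddSubgroup (Fin n → ℝ)} {r : ℕ} {v : Matrix (Fin r) (Fin n) ℝ}
    (hv : IsNear E c x v) : (rowProj v).trace = r := by
  simpa using trace_rowProj (gramDet_pos hv.li).ne'

/-- A single small diagonal direction enlarges all nearly minimal covolumes by a definite factor. -/
lemma WeightBound.exists_direction {E c γ ρ : ℝ} {x : AddSubgroup (Fin n → ℝ)}
    (hW : WeightBound E c x) (hE : 1 < E) (hc : 0 < c) (hx : HasLargeBasis x) (hρ : 0 < ρ)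
    (hγ : ∀ P ∈ flagProjs (Fin n) (Fin n), ∃ h : Fin n → ℝ, ∑ j, h j = 0 ∧ (∀ j, |h j| ≤ ρ) ∧
      ∀ i, γ ≤ volFactor (P i) fun j => Real.exp (h j)) :
    ∃ h : Fin n → ℝ, ∑ j, h j = 0 ∧ (∀ j, |h j| ≤ ρ) ∧
      ∀ (r : ℕ) (v : Matrix (Fin r) (Fin n) ℝ), IsNear E c x v →
        γ ≤ volFactor (rowProj v) fun j => Real.exp (h j) := by
  by_cases hne : ∃ (r : ℕ) (v : Matrix (Fin r) (Fin n) ℝ), IsNear E c x v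
  · obtain ⟨r₀, v₀, hv₀⟩ := hne
    have key : ∀ i : Fin n, ∃ (q : ℕ) (w : Matrix (Fin q) (Fin n) ℝ), IsNear E c x w ∧
        ∀ v : Matrix (Fin i) (Fin n) ℝ, IsNear E c x v → rowProj v = rowProj w := by
      intro i
      by_cases hi : ∃ w : Matrix (Fin i) (Fin n) ℝ, IsNear E c x w
      · obtain ⟨w, hw⟩ := hi
        exact ⟨i, w, hw, fun v hv => (hW.comparable hE hc hx hv hw).2 rfl⟩
      · exact ⟨r₀, v₀, hv₀, fun v hv => (hi ⟨v, hv⟩).elim⟩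
    choose q w hw hwv using key
    obtain ⟨h, h0, hρ', hh⟩ := hγ (fun i => rowProj (w i))
      ⟨fun i => isOrthProj_rowProj (gramDet_pos (hw i).li).ne',
        fun i j => (hW.comparable hE hc hx (hw i) (hw j)).1, fun i => by
        rw [(hw i).trace]
        have h1 := (hw i).pos
        have h2 := (hw i).lt
        rw [Fintype.card_fin, le_sub_iff_add_le]
        exact ⟨by exact_mod_cast h1, by exact_mod_cast h2⟩⟩
    refine ⟨h, h0, hρ', fun r v hv => ?_⟩
    rw [hwv ⟨r, hv.lt⟩ v hv]
    exact hh _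
  · push Not at hne
    exact ⟨0, by simp, fun _ => by simpa using hρ.le, fun r v hv => (hne r v hv).elim⟩

lemma WeightBound.step {E γ ρ : ℝ} (hE : 1 < E) (hρ : 0 < ρ) (hEρ : γ ≤ E * Real.exp (-(n * ρ)))
    (hγ : ∀ P ∈ flagProjs (Fin n) (Fin n), ∃ h : Fin n → ℝ, ∑ j, h j = 0 ∧ (∀ j, |h j| ≤ ρ) ∧
      ∀ i, γ ≤ volFactor (P i) fun j => Real.exp (h j))
    {c : ℝ} {x : AddSubgroup (Fin n → ℝ)} (hc : 0 < c) (hx : HasLargeBasis x)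
    (hW : WeightBound E c x) :
    ∃ d : Fin n → ℝ, (∀ i, 0 < d i) ∧ ∏ i, d i = 1 ∧
      WeightBound E (min 1 (γ * c)) (SW.mapLat (diagonal d) x) := by
  obtain ⟨h, h0, hhρ, hh⟩ := hW.exists_direction hE hc hx hρ hγ
  have hd : ∏ i, Real.exp (h i / 2) = 1 := by
    rw [← Real.exp_sum, ← Finset.sum_div, h0, zero_div, Real.exp_zero]
  refine ⟨fun i => Real.exp (h i / 2), fun i => Real.exp_pos _, hd, ?_⟩
  intro ι _ _ v hv hvx
  have hcard : Fintype.card ι ≤ n := by simpa using hv.fintype_card_le_finrank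
  have hE0 : 0 < E := by linarith
  rcases hcard.eq_or_lt with heq | hlt
  · have := (hx.map_diagonal hd).one_le_gramDet heq hv hvx
    rw [heq, Nat.sub_self, mul_zero, pow_zero, mul_one]
    exact (min_le_left _ _).trans this
  rcases Nat.eq_zero_or_pos (Fintype.card ι) with hzero | hpos
  · have := Fintype.card_eq_zero_iff.1 hzero
    rw [hzero, zero_mul, pow_zero, mul_one, gramDet, det_isEmpty]
    exact min_le_left _ _
  refine (min_le_right _ _).trans ?_
  obtain ⟨w, hw, hwx, rfl⟩ := exists_eq_mul_diagonal hv hvx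
  rw [gramDet_mul_diagonal (gramDet_pos hw).ne']
  simp only [← Real.exp_add, add_halves]
  have hP := isOrthProj_rowProj (gramDet_pos hw).ne'
  have hcw := hW ι w hw hwx
  set G := gramDet w * E ^ (Fintype.card ι * (n - Fintype.card ι)) with hG
  set F := volFactor (rowProj w) fun j => Real.exp (h j) with hF
  have hF1 : Real.exp (-(n * ρ)) ≤ F := by
    refine le_trans (Real.exp_le_exp.2 ?_) (volFactor_exp hP h).1
    have : ∑ j : Fin n, -ρ ≤ ∑ j, rowProj w j j * h j := by
      refine Finset.sum_le_sum fun j _ => ?_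
      have h1 := hP.diag_nonneg j
      have h2 := hP.diag_le_one j
      have h3 := abs_le.1 (hhρ j)
      nlinarith
    simpa using this
  have hFpos : 0 < F := (Real.exp_pos _).trans_le hF1
  suffices γ * c ≤ F * G by rw [hG] at this; linarith
  by_cases hnear : G < E * c
  · let e := (Fintype.equivFin ι).symm
    have hproj : γ ≤ F := by
      have hn : IsNear E c x (w.submatrix e id) :=
        ⟨hpos, hlt, hw.comp e e.injective, fun i => hwx _, by rwa [gramDet_reindex]⟩
      have := hh _ _ hn
      have he : rowProj (w.submatrix e id) = rowProj w := by
        have m1 : ∀ i, (w.submatrix e id) i ∈ Submodule.span ℝ (Set.range w.row) :=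
          fun i => Submodule.subset_span ⟨e i, rfl⟩
        have m2 : ∀ i, w i ∈ Submodule.span ℝ (Set.range (w.submatrix e id).row) :=
          fun i => Submodule.subset_span ⟨e.symm i, by
            change w (e (e.symm i)) = w i
            rw [e.apply_symm_apply]⟩
        have p1 := rowProj_mul_of_mul (mul_rowProj_of_mem_span (gramDet_pos hw).ne' m1)
        have p2 := rowProj_mul_of_mul (mul_rowProj_of_mem_span (gramDet_pos hn.li).ne' m2)
        have p3 := congrArg transpose p2
        rw [transpose_mul, rowProj_transpose, rowProj_transpose] at p3
        rw [← p1, p3]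
      rwa [he] at this
    exact mul_le_mul hproj hcw hc.le hFpos.le
  · push Not at hnear
    calc γ * c ≤ E * Real.exp (-(n * ρ)) * c := by gcongr
      _ = Real.exp (-(n * ρ)) * (E * c) := by ring
      _ ≤ F * G := mul_le_mul hF1 hnear (by positivity) hFpos.le

lemma HasLargeBasis.exists_weightBound_one (hn : 0 < n) {E : ℝ} (hE : 1 < E)
    {x : AddSubgroup (Fin n → ℝ)} (hx : HasLargeBasis x) :
    ∃ d : Fin n → ℝ, (∀ i, 0 < d i) ∧ ∏ i, d i = 1 ∧
      WeightBound E 1 (SW.mapLat (diagonal d) x) := by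
  have hn' : (0 : ℝ) < n := by exact_mod_cast hn
  have hlog := Real.log_pos hE
  have hρ : 0 < Real.log E / (2 * n) := by positivity
  obtain ⟨γ₀, hγ₀, hγ⟩ := exists_uniform_gain (ι := Fin n) (κ := Fin n) hρ
  have hEe : E * Real.exp (-(n * (Real.log E / (2 * n)))) = Real.exp (Real.log E / 2) := by
    nth_rewrite 1 [← Real.exp_log (by linarith : 0 < E)]
    rw [← Real.exp_add]
    congr 1
    field_simp
    ring
  have hγ₁ : 1 < Real.exp (Real.log E / 2) := Real.one_lt_exp_iff.2 (by positivity)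
  obtain ⟨γ, h1γ, hγγ₀, hγE⟩ : ∃ γ, 1 < γ ∧ γ ≤ γ₀ ∧ γ ≤ Real.exp (Real.log E / 2) :=
    ⟨min γ₀ _, lt_min hγ₀ hγ₁, min_le_left _ _, min_le_right _ _⟩
  replace hγ : ∀ P ∈ flagProjs (Fin n) (Fin n), ∃ h : Fin n → ℝ, ∑ j, h j = 0 ∧
      (∀ j, |h j| ≤ Real.log E / (2 * n)) ∧
      ∀ i, γ ≤ volFactor (P i) fun j => Real.exp (h j) := fun P hP => by
    obtain ⟨h, h0, h1, h2⟩ := hγ P hP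
    exact ⟨h, h0, h1, fun i => hγγ₀.trans (h2 i)⟩
  obtain ⟨c, hc, hcx⟩ := hx.exists_pos_le_gramDet
  have hE1 : ∀ m : ℕ, 1 ≤ E ^ m := fun m => one_le_pow₀ hE.le
  have iter : ∀ m : ℕ, ∃ d : Fin n → ℝ, (∀ i, 0 < d i) ∧ ∏ i, d i = 1 ∧
      WeightBound E (min 1 (γ ^ m * c)) (SW.mapLat (diagonal d) x) := by
    intro m
    induction m with
    | zero =>
      refine ⟨1, by simp, by simp, ?_⟩
      rw [show (diagonal (1 : Fin n → ℝ)) = 1 from diagonal_one, mapLat_one]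
      intro ι _ _ v hv hvx
      refine (min_le_right _ _).trans ?_
      rw [pow_zero, one_mul]
      exact (hcx ι v hv hvx).trans (le_mul_of_one_le_right (gramDet_nonneg v) (hE1 _))
    | succ m ih =>
      obtain ⟨d, hd, hd1, hW⟩ := ih
      obtain ⟨d', hd', hd1', hW'⟩ := WeightBound.step hE hρ (hγE.trans hEe.ge) hγ
        (lt_min one_pos (by positivity)) (hx.map_diagonal hd1) hW
      refine ⟨fun i => d' i * d i, fun i => mul_pos (hd' i) (hd i), by
        rw [Finset.prod_mul_distrib, hd1, hd1', one_mul], ?_⟩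
      rw [← diagonal_mul_diagonal, ← mapLat_mul]
      intro ι _ _ v hv hvx
      refine le_trans ?_ (hW' ι v hv hvx)
      refine le_min (min_le_left _ _) ?_
      rcases le_total 1 (γ ^ m * c) with h | h
      · rw [min_eq_left h, mul_one]
        exact (min_le_left _ _).trans h1γ.le
      · rw [min_eq_right h, ← mul_assoc, ← pow_succ']
        exact min_le_right _ _
  obtain ⟨m, hm⟩ := pow_unbounded_of_one_lt c⁻¹ h1γ
  obtain ⟨d, hd, hd1, hW⟩ := iter m
  rw [min_eq_left (by rw [inv_lt_iff_one_lt_mul₀ hc] at hm; exact hm.le)] at hW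
  exact ⟨d, hd, hd1, hW⟩

end Weights

section Covolume

variable {n : ℕ}

lemma gvol_eq_sqrt_gramDet {r : ℕ} (v : Fin r → (Fin n → ℝ)) :
    gvol v = Real.sqrt (gramDet (Matrix.of v)) := by
  rw [gvol, gramDet]
  congr 2

lemma IsUnimodularLattice.hasLargeBasis {L : AddSubgroup (Fin n → ℝ)}
    (hL : IsUnimodularLattice L) : HasLargeBasis L := by
  obtain ⟨⟨-, hspan⟩, hcov⟩ := hL
  have hne : {c | covolSpec L c}.Nonempty := by
    by_contra! h
    rw [covol, h, Real.sInf_empty] at hcov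
    exact zero_ne_one hcov
  obtain ⟨c, r, v, hv, hLv, rfl⟩ := hne
  have h1 : 1 ≤ gvol v := by
    rw [← hcov]
    refine csInf_le ⟨0, ?_⟩ ⟨r, v, hv, hLv, rfl⟩
    rintro _ ⟨_, _, -, -, rfl⟩
    exact Real.sqrt_nonneg _
  have hr : r = n := by
    have h2 : Submodule.span ℝ (Set.range v) = ⊤ := by
      rw [eq_top_iff, ← hspan, Submodule.span_le, hLv]
      exact (AddSubgroup.closure_le (Submodule.span ℝ (Set.range v)).toAddSubgroup).2
        Submodule.subset_span
    have h3 := finrank_span_eq_card hv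
    rw [h2] at h3
    simpa using h3.symm
  subst hr
  refine ⟨Matrix.of v, ?_, hLv⟩
  rwa [gvol_eq_sqrt_gramDet, Real.one_le_sqrt] at h1

lemma HasLargeBasis.exists_covolSpec {x Λ : AddSubgroup (Fin n → ℝ)} (hx : HasLargeBasis x)
    (hΛ : Λ ≤ x) : ∃ c, covolSpec Λ c := by
  have := hx.discreteTopology
  let Y := AddSubgroup.toIntSubmodule Λ
  have hY : DiscreteTopology Y := discreteTopology_of_le (X := AddSubgroup.toIntSubmodule x) hΛ
  let b := Module.finBasis ℤ Y
  have hb : LinearIndependent ℤ fun i => (b i : Fin n → ℝ) :=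
    b.linearIndependent.map' Y.subtype (Submodule.ker_subtype Y)
  refine ⟨_, _, fun i => (b i : Fin n → ℝ), linearIndependent_real_of_int hb fun i => (b i).2,
    ?_, rfl⟩
  apply AddSubgroup.toIntSubmodule.injective
  rw [toIntSubmodule_closure]
  have h := congrArg (Submodule.map Y.subtype) b.span_eq
  rw [Submodule.map_span, ← Set.range_comp, Submodule.map_top, Submodule.range_subtype] at h
  exact h.symm

lemma WeightBound.le_covol {E : ℝ} (hE : 1 < E) {x Λ : AddSubgroup (Fin n → ℝ)}
    (hx : HasLargeBasis x) (hW : WeightBound E 1 x) (hΛ : Λ ≤ x) {δ : ℝ}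
    (hδE : δ ^ 2 * E ^ (n * n) ≤ 1) : δ ≤ covol Λ := by
  refine le_csInf (hx.exists_covolSpec hΛ) ?_
  rintro _ ⟨r, v, hv, rfl, rfl⟩
  rw [gvol_eq_sqrt_gramDet]
  apply Real.le_sqrt_of_sq_le
  have h1 := hW (Fin r) (Matrix.of v) hv fun i => hΛ (AddSubgroup.subset_closure ⟨i, rfl⟩)
  have hr : r ≤ n := by simpa using hv.fintype_card_le_finrank
  rw [Fintype.card_fin] at h1
  have h2 : E ^ (r * (n - r)) ≤ E ^ (n * n) :=
    pow_le_pow_right₀ hE.le (Nat.mul_le_mul hr (Nat.sub_le n r))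
  have h3 := h1.trans (mul_le_mul_of_nonneg_left h2 (gramDet_nonneg _))
  exact le_of_mul_le_mul_right (hδE.trans h3) (by positivity)

lemma HasLargeBasis.exists_rk_eq {x : AddSubgroup (Fin n → ℝ)} (hx : HasLargeBasis x) {k : ℕ}
    (hk : k ≤ n) : ∃ Λ ≤ x, rk Λ = k := by
  obtain ⟨b, hb, rfl⟩ := hx
  let v : Fin k → (Fin n → ℝ) := fun i => b (Fin.castLE hk i)
  have hv : LinearIndependent ℝ v :=
    (linearIndependent_of_gramDet_ne_zero (by linarith)).comp _ (Fin.castLE_injective hk)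
  refine ⟨AddSubgroup.closure (Set.range v), AddSubgroup.closure_mono ?_, ?_⟩
  · rintro _ ⟨i, rfl⟩
    exact ⟨_, rfl⟩
  · have : Submodule.span ℝ (AddSubgroup.closure (Set.range v) : Set (Fin n → ℝ)) =
        Submodule.span ℝ (Set.range v) := by
      refine le_antisymm (Submodule.span_le.2 ?_) (Submodule.span_mono AddSubgroup.subset_closure)
      exact (AddSubgroup.closure_le (Submodule.span ℝ (Set.range v)).toAddSubgroup).2
        Submodule.subset_span
    rw [rk, this, finrank_span_eq_card hv, Fintype.card_fin]

lemma exists_one_lt_mul_pow_le_one {s : ℝ} (hs : s < 1) (m : ℕ) :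
    ∃ E : ℝ, 1 < E ∧ s * E ^ m ≤ 1 := by
  have h : ∀ᶠ E in 𝓝[>] (1 : ℝ), s * E ^ m < 1 := by
    refine nhdsWithin_le_nhds (ContinuousAt.eventually_lt ?_ continuousAt_const (by simpa using hs))
    fun_prop
  obtain ⟨E, h1, h2⟩ := (h.and self_mem_nhdsWithin).exists
  exact ⟨E, h2, h1.le⟩

end Covolume

end SW

/-- **Corollary 4.1.** For any `x ∈ ℒ_n`, `ε > 0` and `k ∈ {1, …, n}` there is `a ∈ A` with
`α_k(ax) ≥ 1 - ε`. -/
theorem SW.alphak_almost_one (n : ℕ) (hn : 0 < n)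
    (L : AddSubgroup (Fin n → ℝ)) (hL : SW.IsUnimodularLattice L)
    (ε : ℝ) (hε : 0 < ε) (k : ℕ) (hk1 : 1 ≤ k) (hk2 : k ≤ n) :
    ∃ a ∈ SW.Apos n, 1 - ε ≤ SW.alphak k (SW.mapLat a L) := by
  have hLb := hL.hasLargeBasis
  have hδ : 0 ≤ max 0 (1 - ε) := le_max_left _ _
  have hδ1 : max 0 (1 - ε) < 1 := max_lt one_pos (by linarith)
  set δ := max 0 (1 - ε)
  obtain ⟨E, hE, hδE⟩ := SW.exists_one_lt_mul_pow_le_one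
    (pow_lt_one₀ (pow_nonneg hδ k) (pow_lt_one₀ hδ hδ1 (by omega)) two_ne_zero) (n * n)
  obtain ⟨d, hd, hd1, hW⟩ := hLb.exists_weightBound_one hn hE
  have hx := hLb.map_diagonal hd1
  refine ⟨_, ⟨d, hd, hd1, rfl⟩, (le_max_right 0 _).trans (le_csInf ?_ ?_)⟩
  · obtain ⟨Λ, hΛ, hrk⟩ := hx.exists_rk_eq hk2
    exact ⟨_, Λ, hΛ, hrk, rfl⟩
  · rintro _ ⟨Λ, hΛ, -, rfl⟩
    have h := hW.le_covol hE hx hΛ hδE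
    calc δ = (δ ^ k) ^ ((k : ℝ)⁻¹) := (Real.pow_rpow_inv_natCast hδ (by omega)).symm
      _ ≤ _ := Real.rpow_le_rpow (pow_nonneg hδ k) h (by positivity)
end
end

section
/- Let x ∈ ℒ_n have diagonal Korkine–Zolotarev coefficients A₁,…,A_n, and let n = n₁ + ⋯ + n_k with each n_i a positive integer. Set m₀ = 0, m_i = n₁ + ⋯ + n_i and d_i = ∏_{j=m_{i−1}+1}^{m_i} A_j. If 2·A_{m_{i−1}+1}^{n_i} ≥ d_i · γ_{n_i+1}^{(n_i+1)/2} for each i, then covrad²(x) ≤ Σ_{i=1}^k ( A_{m_{i−1}+1}² − A_{m_{i−1}+1}^{2n_i+2} / (d_i² · γ_{n_i+1}^{n_i+1}) ). -/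
open scoped BigOperators
open Matrix Topology Filter

noncomputable section

namespace SW

open MeasureTheory

/-! ### Gram determinants and covolumes -/

lemma sum_sq_nonneg {ι : Type*} [Fintype ι] (v : ι → ℝ) : 0 ≤ ∑ i, v i ^ 2 :=
  Finset.sum_nonneg fun i _ => sq_nonneg (v i)

lemma gvol_eq_abs_det {n r : ℕ} (v : Fin r → (Fin n → ℝ)) (Y : Matrix (Fin r) (Fin r) ℝ)
    (h : ∀ i j, einner (v i) (v j) = Y i ⬝ᵥ Y j) : gvol v = |Y.det| := by
  have hY : (Matrix.of fun i j => einner (v i) (v j)) = Y * Yᵀ := by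
    ext i j
    simp [h, Matrix.mul_apply, dotProduct]
  rw [gvol, hY, Matrix.det_mul, Matrix.det_transpose, ← sq, Real.sqrt_sq_eq_abs]

lemma covolSpec.exists_basis {n : ℕ} {Λ : AddSubgroup (Fin n → ℝ)} {c : ℝ}
    (hspan : Submodule.span ℝ (Λ : Set (Fin n → ℝ)) = ⊤) (h : covolSpec Λ c) :
    0 ≤ c ∧ ∃ b : Module.Basis (Fin n) ℝ (Fin n → ℝ),
      Λ = (Submodule.span ℤ (Set.range b)).toAddSubgroup ∧
      volume (ZSpan.fundamentalDomain b) = ENNReal.ofReal c := by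
  obtain ⟨r, v, hv, rfl, rfl⟩ := h
  have hle : ⊤ ≤ Submodule.span ℝ (Set.range v) := by
    rw [← hspan, ← Submodule.span_int_eq_addSubgroupClosure, Submodule.coe_toAddSubgroup,
      Submodule.span_span_of_tower]
  have hr : r = n := by
    simpa using (Module.finrank_eq_card_basis (Module.Basis.mk hv hle)).symm
  subst hr
  refine ⟨Real.sqrt_nonneg _, Module.Basis.mk hv hle, ?_, ?_⟩
  · rw [Module.Basis.coe_mk, Submodule.span_int_eq_addSubgroupClosure]
  · rw [ZSpan.volume_fundamentalDomain, Module.Basis.coe_mk,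
      gvol_eq_abs_det v (Matrix.of v) fun i j => rfl]

lemma covolSpec.unique {n : ℕ} {Λ : AddSubgroup (Fin n → ℝ)} {c c' : ℝ}
    (hspan : Submodule.span ℝ (Λ : Set (Fin n → ℝ)) = ⊤) (h : covolSpec Λ c)
    (h' : covolSpec Λ c') : c = c' := by
  obtain ⟨hc, b, rfl, hb⟩ := h.exists_basis hspan
  have : Countable (Submodule.span ℤ (Set.range b)).toAddSubgroup :=
    inferInstanceAs (Countable (Submodule.span ℤ (Set.range b)))
  obtain ⟨hc', b', hΛ, hb'⟩ := h'.exists_basis hspan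
  have hF' := ZSpan.isAddFundamentalDomain' b' volume
  rw [← hΛ] at hF'
  have hF := (ZSpan.isAddFundamentalDomain' b volume).measure_eq hF'
  rw [hb, hb'] at hF
  exact (ENNReal.ofReal_eq_ofReal_iff hc hc').1 hF

lemma covolSpec.covol_eq {n : ℕ} {Λ : AddSubgroup (Fin n → ℝ)} {c : ℝ}
    (hspan : Submodule.span ℝ (Λ : Set (Fin n → ℝ)) = ⊤) (h : covolSpec Λ c) :
    covol Λ = c := by
  have hset : {c | covolSpec Λ c} = {c} :=
    Set.eq_singleton_iff_unique_mem.2 ⟨h, fun c' h' => covolSpec.unique hspan h' h⟩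
  rw [covol, hset, csInf_singleton]

lemma isUnimodularLattice_closure_range {n : ℕ} (B : Fin n → Fin n → ℝ)
    (hB : |(Matrix.of B).det| = 1) :
    IsUnimodularLattice (AddSubgroup.closure (Set.range B)) := by
  have hdet : (Matrix.of B).det ≠ 0 := fun h => by simp [h] at hB
  have hli : LinearIndependent ℝ B := Matrix.linearIndependent_rows_iff_isUnit.2
    ((Matrix.isUnit_iff_isUnit_det (Matrix.of B)).2 (isUnit_iff_ne_zero.2 hdet))
  have hle : ⊤ ≤ Submodule.span ℝ (Set.range B) :=
    (LinearIndependent.span_eq_top_of_card_eq_finrank' hli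
      (by rw [Module.finrank_fin_fun, Fintype.card_fin])).ge
  have hspan : Submodule.span ℝ (AddSubgroup.closure (Set.range B) : Set (Fin n → ℝ)) = ⊤ := by
    rw [← Submodule.span_int_eq_addSubgroupClosure, Submodule.coe_toAddSubgroup,
      Submodule.span_span_of_tower]
    exact top_le_iff.1 hle
  refine ⟨⟨?_, hspan⟩, ?_⟩
  · have hb : AddSubgroup.closure (Set.range B) =
        (Submodule.span ℤ (Set.range (Module.Basis.mk hli hle))).toAddSubgroup := by
      rw [Module.Basis.coe_mk, Submodule.span_int_eq_addSubgroupClosure]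
    rw [hb]
    infer_instance
  · rw [covolSpec.covol_eq hspan ⟨n, B, hli, rfl, rfl⟩,
      gvol_eq_abs_det B (Matrix.of B) fun i j => rfl, hB]

/-! ### The Hermite constant -/

lemma enorm_sq {n : ℕ} (v : Fin n → ℝ) : enorm v ^ 2 = ∑ i, v i ^ 2 :=
  Real.sq_sqrt (sum_sq_nonneg v)

lemma enorm_nonneg {n : ℕ} (v : Fin n → ℝ) : 0 ≤ enorm v := Real.sqrt_nonneg _

lemma shortest_nonneg {n : ℕ} (L : AddSubgroup (Fin n → ℝ)) : 0 ≤ shortest L := by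
  refine Real.sInf_nonneg ?_
  rintro t ⟨w, -, -, rfl⟩
  exact enorm_nonneg w

lemma shortest_le {n : ℕ} {L : AddSubgroup (Fin n → ℝ)} {w : Fin n → ℝ} (hw : w ∈ L)
    (h0 : w ≠ 0) : shortest L ≤ enorm w := by
  refine csInf_le ⟨0, ?_⟩ ⟨w, hw, h0, rfl⟩
  rintro t ⟨w, -, -, rfl⟩
  exact enorm_nonneg w

/-- Minkowski's theorem for unimodular lattices and a cube. -/
lemma IsUnimodularLattice.exists_ne_zero_abs_lt {n : ℕ} (hn : 0 < n)
    {L : AddSubgroup (Fin n → ℝ)} (hL : IsUnimodularLattice L) :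
    ∃ w ∈ L, w ≠ 0 ∧ ∀ i, |w i| < 2 := by
  obtain ⟨⟨-, hspan⟩, hcov⟩ := hL
  have hne : {c | covolSpec L c}.Nonempty := by
    by_contra h
    rw [Set.not_nonempty_iff_eq_empty] at h
    simp [covol, h] at hcov
  obtain ⟨c, hc⟩ := hne
  obtain rfl : c = 1 := (hc.covol_eq hspan).symm.trans hcov
  obtain ⟨-, b, rfl, hb⟩ := hc.exists_basis hspan
  have : Countable (Submodule.span ℤ (Set.range b)).toAddSubgroup :=
    inferInstanceAs (Countable (Submodule.span ℤ (Set.range b)))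
  obtain ⟨w, hw0, hw⟩ := exists_ne_zero_mem_lattice_of_measure_mul_two_pow_lt_measure
    (s := Metric.ball (0 : Fin n → ℝ) 2) (ZSpan.isAddFundamentalDomain' b volume)
    (fun x hx => by simpa using hx) (convex_ball _ _) (by
      rw [hb, Real.volume_pi_ball _ two_pos]
      simp only [ENNReal.ofReal_one, one_mul, Module.finrank_fin_fun, Fintype.card_fin]
      rw [show (2 : ENNReal) = ENNReal.ofReal 2 by simp, ← ENNReal.ofReal_pow two_pos.le,
        ENNReal.ofReal_lt_ofReal_iff (by positivity)]
      exact pow_lt_pow_left₀ (by norm_num) two_pos.le hn.ne')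
  refine ⟨w, w.2, fun h => hw0 (Subtype.ext h), fun i => ?_⟩
  exact (norm_le_pi_norm (w : Fin n → ℝ) i).trans_lt (by simpa using hw)

lemma bddAbove_hermiteConst {n : ℕ} (hn : 0 < n) :
    BddAbove {c | ∃ L : AddSubgroup (Fin n → ℝ), IsUnimodularLattice L ∧
      c = shortest L ^ 2} := by
  refine ⟨n * 4, ?_⟩
  rintro c ⟨L, hL, rfl⟩
  obtain ⟨w, hw, hw0, hlt⟩ := hL.exists_ne_zero_abs_lt hn
  calc shortest L ^ 2 ≤ enorm w ^ 2 := by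
        gcongr
        exacts [shortest_nonneg L, shortest_le hw hw0]
    _ = ∑ i, w i ^ 2 := enorm_sq w
    _ ≤ ∑ _i : Fin n, (4 : ℝ) := by
        gcongr with i
        have := hlt i
        rw [abs_lt] at this
        nlinarith
    _ = n * 4 := by simp

lemma hermiteConst_nonneg (n : ℕ) : 0 ≤ hermiteConst n := by
  refine Real.sSup_nonneg ?_
  rintro c ⟨L, -, rfl⟩
  positivity

/-- Integer combinations of the rows of a matrix. -/
lemma exists_vecMul_of_mem_closure_range {n r : ℕ} (B : Fin r → Fin n → ℝ) {w : Fin n → ℝ}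
    (hw : w ∈ AddSubgroup.closure (Set.range B)) :
    ∃ z : Fin r → ℤ, w = ∑ a, (z a : ℝ) • B a := by
  rw [← Submodule.span_int_eq_addSubgroupClosure, Submodule.mem_toAddSubgroup,
    Submodule.mem_span_range_iff_exists_fun] at hw
  obtain ⟨z, rfl⟩ := hw
  exact ⟨z, Finset.sum_congr rfl fun a _ => (Int.cast_smul_eq_zsmul ℝ _ _).symm⟩

/-- The defining inequality of the Hermite constant, for the lattice spanned by the rows of an
arbitrary nonsingular matrix. -/
lemma pow_le_hermiteConst_pow_mul_det_sq {n : ℕ} (hn : 0 < n) (B : Matrix (Fin n) (Fin n) ℝ)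
    (hB : B.det ≠ 0) {α : ℝ} (hα : 0 ≤ α)
    (h : ∀ z : Fin n → ℤ, z ≠ 0 → α ^ 2 ≤ ∑ j, (∑ a, (z a : ℝ) * B a j) ^ 2) :
    α ^ (2 * n) ≤ hermiteConst n ^ n * B.det ^ 2 := by
  have hd : 0 < |B.det| := abs_pos.2 hB
  set s : ℝ := |B.det| ^ (-(n : ℝ)⁻¹) with hs
  have hspos : 0 < s := Real.rpow_pos_of_pos hd _
  have hsn : s ^ n * |B.det| = 1 := by
    rw [hs, ← Real.rpow_natCast, ← Real.rpow_mul hd.le, neg_mul,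
      inv_mul_cancel₀ (by positivity), Real.rpow_neg_one, inv_mul_cancel₀ hd.ne']
  have hU := isUnimodularLattice_closure_range (fun a => s • B a) (by
    rw [show Matrix.of (fun a => s • B a) = s • B from rfl, Matrix.det_smul,
      Fintype.card_fin, abs_mul, abs_of_pos (by positivity), hsn])
  have hmem : shortest (AddSubgroup.closure (Set.range fun a => s • B a)) ^ 2 ≤ hermiteConst n :=
    le_csSup (bddAbove_hermiteConst hn) ⟨_, hU, rfl⟩
  have hle : s * α ≤ shortest (AddSubgroup.closure (Set.range fun a => s • B a)) := by
    obtain ⟨w₀, hw₀, hne₀, -⟩ := hU.exists_ne_zero_abs_lt hn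
    refine le_csInf ⟨_, w₀, hw₀, hne₀, rfl⟩ ?_
    rintro t ⟨w, hw, hne, rfl⟩
    obtain ⟨z, rfl⟩ := exists_vecMul_of_mem_closure_range _ hw
    have hz : z ≠ 0 := by
      rintro rfl
      simp at hne
    refine Real.le_sqrt_of_sq_le ?_
    calc (s * α) ^ 2 = s ^ 2 * α ^ 2 := mul_pow _ _ _
      _ ≤ s ^ 2 * ∑ j, (∑ a, (z a : ℝ) * B a j) ^ 2 := by gcongr; exact h z hz
      _ = _ := by
        rw [Finset.mul_sum]
        refine Finset.sum_congr rfl fun j _ => ?_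
        rw [← mul_pow, Finset.mul_sum, Finset.sum_apply]
        congr 1
        refine Finset.sum_congr rfl fun a _ => ?_
        simp
        ring
  have h1 : (s * α) ^ 2 ≤ hermiteConst n := le_trans (by gcongr) hmem
  calc α ^ (2 * n) = ((s * α) ^ 2) ^ n * B.det ^ 2 := by
        rw [← sq_abs B.det]
        calc α ^ (2 * n) = α ^ (2 * n) * (s ^ n * |B.det|) ^ 2 := by rw [hsn]; ring
          _ = _ := by ring
    _ ≤ hermiteConst n ^ n * B.det ^ 2 := by gcongr

lemma hermiteConst_pos {n : ℕ} (hn : 0 < n) : 0 < hermiteConst n := by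
  have h := pow_le_hermiteConst_pow_mul_det_sq hn (1 : Matrix (Fin n) (Fin n) ℝ) (by simp)
    zero_le_one fun z hz => by
      obtain ⟨i, hi⟩ := Function.ne_iff.1 hz
      have h1 : (1 : ℝ) ≤ (z i : ℝ) ^ 2 := by
        rw [← sq_abs]
        have : (1 : ℝ) ≤ |(z i : ℝ)| := by exact_mod_cast Int.one_le_abs hi
        nlinarith
      simp only [Matrix.one_apply, mul_ite, mul_one, mul_zero, Finset.sum_ite_eq',
        Finset.mem_univ, if_true, one_pow]
      exact h1.trans (Finset.single_le_sum (f := fun j => (z j : ℝ) ^ 2)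
        (fun j _ => sq_nonneg _) (Finset.mem_univ i))
  refine lt_of_le_of_ne (hermiteConst_nonneg n) fun h0 => ?_
  norm_num [← h0, hn.ne'] at h

end SW

namespace SW

/-! ### Woods' bound for the covering radius of a single block -/

/-- The Hermite inequality for the lattice generated by the rows of `T` and one further vector
with component `u` in the span of `T` and squared height `τ`. -/
lemma pow_le_hermiteConst_of_augmented {r : ℕ} (T : Matrix (Fin r) (Fin r) ℝ) (hT : T.det ≠ 0)
    {α : ℝ} (hα : 0 ≤ α)
    (hmin : ∀ z : Fin r → ℤ, z ≠ 0 → α ^ 2 ≤ ∑ j, (∑ a, (z a : ℝ) * T a j) ^ 2)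
    (u : Fin r → ℝ) {τ : ℝ} (hτ : 0 < τ)
    (h : ∀ (z : Fin r → ℤ) (k : ℤ), k ≠ 0 →
      α ^ 2 ≤ ∑ j, (k * u j + ∑ a, (z a : ℝ) * T a j) ^ 2 + k ^ 2 * τ) :
    α ^ (2 * (r + 1)) ≤ hermiteConst (r + 1) ^ (r + 1) * (T.det ^ 2 * τ) := by
  let B : Matrix (Fin (r + 1)) (Fin (r + 1)) ℝ :=
    Fin.cons (Fin.cons (√τ) u) fun a => Fin.cons 0 (T a)
  have hdet : B.det = √τ * T.det := by
    rw [Matrix.det_succ_column_zero, Fin.sum_univ_succ]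
    have : B.submatrix (Fin.succAbove 0) Fin.succ = T := by
      rw [Fin.succAbove_zero]
      rfl
    rw [this]
    simp [B]
  have hB := pow_le_hermiteConst_pow_mul_det_sq r.succ_pos B
    (by rw [hdet]; exact mul_ne_zero (Real.sqrt_pos.2 hτ).ne' hT) hα fun z hz => by
      have key : ∑ j, (∑ a, (z a : ℝ) * B a j) ^ 2 =
          ∑ j, (z 0 * u j + ∑ a : Fin r, (z a.succ : ℝ) * T a j) ^ 2 + z 0 ^ 2 * τ := by
        rw [Fin.sum_univ_succ, add_comm]
        simp [Fin.sum_univ_succ, B, mul_pow, Real.sq_sqrt hτ.le]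
      rw [key]
      by_cases h0 : z 0 = 0
      · have hz' : (fun a : Fin r => z a.succ) ≠ 0 := by
          intro h'
          refine hz (funext fun i => ?_)
          refine Fin.cases h0 (fun a => congrFun h' a) i
        simpa [h0] using hmin _ hz'
      · exact h _ _ h0
  rw [hdet, mul_pow, Real.sq_sqrt hτ.le, mul_comm τ] at hB
  exact hB

lemma le_sum_add_smul_sq {ι : Type*} [Fintype ι] {a b : ι → ℝ} {s ρ : ℝ} (hs : 0 ≤ s)
    (hs1 : s ≤ 1) (h : ρ ≤ ∑ j, a j ^ 2) :
    (1 - s) * ρ - s * ∑ j, b j ^ 2 ≤ ∑ j, (a j + s * b j) ^ 2 := by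
  calc (1 - s) * ρ - s * ∑ j, b j ^ 2 ≤ (1 - s) * ∑ j, a j ^ 2 - s * ∑ j, b j ^ 2 := by
        gcongr
    _ = ∑ j, ((1 - s) * a j ^ 2 - s * b j ^ 2) := by
        rw [Finset.sum_sub_distrib, Finset.mul_sum, Finset.mul_sum]
    _ ≤ _ := by
        gcongr with j
        nlinarith [mul_nonneg hs (sq_nonneg (a j + b j)),
          mul_nonneg (sq_nonneg s) (sq_nonneg (b j))]

/-- A deep hole can be moved slightly so that its double stays away from the lattice. -/
lemma exists_generic_point {r : ℕ} (hr : 0 < r) (T : Matrix (Fin r) (Fin r) ℝ)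
    (hT : T.det ≠ 0) (u : Fin r → ℝ) {ρ σ : ℝ} (hσ : σ < ρ)
    (h : ∀ z : Fin r → ℤ, ρ ≤ ∑ j, (u j + ∑ a, (z a : ℝ) * T a j) ^ 2) :
    ∃ u' : Fin r → ℝ, ∃ ρ' > σ, ∃ δ > 0,
      (∀ z : Fin r → ℤ, ρ' ≤ ∑ j, (u' j + ∑ a, (z a : ℝ) * T a j) ^ 2) ∧
      ∀ z : Fin r → ℤ, δ ≤ ∑ j, (2 * u' j + ∑ a, (z a : ℝ) * T a j) ^ 2 := by
  let i₀ : Fin r := ⟨0, hr⟩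
  let e : Fin r → ℝ := fun j => T⁻¹ j i₀
  have he : ∀ a, ∑ j, T a j * e j = if a = i₀ then 1 else 0 := fun a => by
    have := congrFun (congrFun (Matrix.mul_nonsing_inv T (isUnit_iff_ne_zero.2 hT)) a) i₀
    simpa [Matrix.mul_apply, Matrix.one_apply] using this
  set β := ∑ j, T i₀ j ^ 2 with hβ
  have hβ0 : 0 ≤ β := sum_sq_nonneg _
  set s₀ := min 1 ((ρ - σ) / (|ρ| + β + 1)) with hs₀
  have hs₀pos : 0 < s₀ := lt_min one_pos (div_pos (by linarith) (by positivity))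
  obtain ⟨θ, hθ, hθ1, hθ2⟩ :=
    exists_irrational_btwn (lt_add_of_pos_right (∑ j, u j * e j) hs₀pos)
  set s := θ - ∑ j, u j * e j with hs
  have hs0 : 0 < s := by linarith
  have hs1 : s < 1 := by have := min_le_left 1 ((ρ - σ) / (|ρ| + β + 1)); linarith
  have hs2 : s * (|ρ| + β + 1) < ρ - σ := by
    rw [← lt_div_iff₀ (by positivity)]
    have := min_le_right 1 ((ρ - σ) / (|ρ| + β + 1))
    linarith
  have hη : 0 < |2 * θ - round (2 * θ)| := by
    refine abs_pos.2 (sub_ne_zero.2 ?_)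
    have : Irrational (2 * θ) := by exact_mod_cast hθ.ratCast_mul (q := 2) (by norm_num)
    exact this.ne_int _
  refine ⟨fun j => u j + s * T i₀ j, (1 - s) * ρ - s * β, ?_,
    |2 * θ - round (2 * θ)| ^ 2 / (∑ j, e j ^ 2 + 1), ?_, fun z => ?_, fun z => ?_⟩
  · nlinarith [le_abs_self ρ]
  · have := sum_sq_nonneg e
    positivity
  · refine (le_sum_add_smul_sq hs0.le hs1.le (h z)).trans_eq ?_
    exact Finset.sum_congr rfl fun j _ => by ring
  · have hx : ∑ j, (2 * (u j + s * T i₀ j) + ∑ a, (z a : ℝ) * T a j) * e j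
        = 2 * θ + z i₀ := by
      have h1 : ∑ j, (∑ a, (z a : ℝ) * T a j) * e j = z i₀ := by
        simp_rw [Finset.sum_mul, mul_assoc]
        rw [Finset.sum_comm]
        simp_rw [← Finset.mul_sum, he]
        simp
      have h2 : ∑ j, T i₀ j * e j = 1 := by simp [he]
      calc _ = ∑ j, (2 * (u j * e j) + 2 * s * (T i₀ j * e j)
              + (∑ a, (z a : ℝ) * T a j) * e j) := Finset.sum_congr rfl fun j _ => by ring
        _ = _ := by
          rw [Finset.sum_add_distrib, Finset.sum_add_distrib, ← Finset.mul_sum,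
            ← Finset.mul_sum, h1, h2, hs]
          ring
    have hcs := Finset.sum_mul_sq_le_sq_mul_sq Finset.univ
      (fun j => 2 * (u j + s * T i₀ j) + ∑ a, (z a : ℝ) * T a j) e
    rw [hx] at hcs
    have hround := round_le (2 * θ) (-z i₀)
    rw [Int.cast_neg, sub_neg_eq_add] at hround
    have := sum_sq_nonneg e
    rw [div_le_iff₀ (by positivity)]
    have h3 := sum_sq_nonneg fun j => 2 * (u j + s * T i₀ j) + ∑ a, (z a : ℝ) * T a j
    calc |2 * θ - round (2 * θ)| ^ 2 ≤ |2 * θ + z i₀| ^ 2 := by gcongr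
      _ = (2 * θ + z i₀) ^ 2 := sq_abs _
      _ ≤ _ := by linarith

lemma sum_neg_comb_sq {r : ℕ} (T : Matrix (Fin r) (Fin r) ℝ) (u : Fin r → ℝ) (k : ℝ)
    (z : Fin r → ℤ) :
    ∑ j, (-k * u j + ∑ a, (z a : ℝ) * T a j) ^ 2 =
      ∑ j, (k * u j + ∑ a, ((-z) a : ℝ) * T a j) ^ 2 := by
  refine Finset.sum_congr rfl fun j _ => ?_
  simp only [Pi.neg_apply, Int.cast_neg, neg_mul, Finset.sum_neg_distrib]
  ring

/-- Woods' bound: the covering radius of the lattice generated by the rows of `T`, in terms of a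
lower bound `α` for its shortest vector and its covolume. -/
lemma exists_dist_sq_lt_of_hermite {r : ℕ} (hr : 0 < r) (T : Matrix (Fin r) (Fin r) ℝ)
    (hT : T.det ≠ 0) {α : ℝ} (hα : 0 < α)
    (hmin : ∀ z : Fin r → ℤ, z ≠ 0 → α ^ 2 ≤ ∑ j, (∑ a, (z a : ℝ) * T a j) ^ 2)
    (hcond : |T.det| * hermiteConst (r + 1) ^ (((r : ℝ) + 1) / 2) ≤ 2 * α ^ r)
    (u : Fin r → ℝ) {ρ : ℝ}
    (hρ : α ^ 2 - α ^ (2 * r + 2) / (|T.det| ^ 2 * hermiteConst (r + 1) ^ (r + 1)) < ρ) :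
    ∃ z : Fin r → ℤ, ∑ j, (u j + ∑ a, (z a : ℝ) * T a j) ^ 2 < ρ := by
  by_contra! hcon
  obtain ⟨v, σ, hσ, δ, hδ, hv, hv2⟩ := exists_generic_point hr T hT u hρ hcon
  have hH := hermiteConst_pos r.succ_pos
  set H := hermiteConst (r + 1)
  rw [sq_abs] at hσ
  have hd2 : 0 < T.det ^ 2 := by positivity
  have hD : 0 < T.det ^ 2 * H ^ (r + 1) := by positivity
  set t := α ^ (2 * r + 2) / (T.det ^ 2 * H ^ (r + 1)) with ht
  have htpos : 0 < t := by positivity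
  have ht4 : α ^ 2 ≤ 4 * t := by
    have h1 : (H ^ (((r : ℝ) + 1) / 2)) ^ 2 = H ^ (r + 1) := by
      rw [← Real.rpow_natCast, ← Real.rpow_mul hH.le, ← Real.rpow_natCast]
      congr 1
      push_cast
      ring
    have h2 : T.det ^ 2 * H ^ (r + 1) ≤ 4 * α ^ (2 * r) := by
      calc T.det ^ 2 * H ^ (r + 1) = (|T.det| * H ^ (((r : ℝ) + 1) / 2)) ^ 2 := by
            rw [mul_pow, h1, sq_abs]
        _ ≤ (2 * α ^ r) ^ 2 := by gcongr
        _ = 4 * α ^ (2 * r) := by ring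
    rw [ht, mul_div_assoc', le_div_iff₀ hD]
    calc α ^ 2 * (T.det ^ 2 * H ^ (r + 1)) ≤ α ^ 2 * (4 * α ^ (2 * r)) := by gcongr
      _ = _ := by ring
  have hα2 : 0 < α ^ 2 := by positivity
  obtain ⟨τ, hτmax, hτt⟩ : ∃ τ, max (t / 2) (max (α ^ 2 - σ) ((α ^ 2 - δ) / 4)) ≤ τ ∧ τ < t :=
    ⟨_, le_rfl, max_lt (by linarith) (max_lt (by linarith) (by linarith))⟩
  obtain ⟨hτ1, hτ2, hτ3⟩ : t / 2 ≤ τ ∧ α ^ 2 - σ ≤ τ ∧ (α ^ 2 - δ) / 4 ≤ τ := by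
    simpa using hτmax
  have hτ : 0 < τ := by linarith
  have key := pow_le_hermiteConst_of_augmented T hT hα.le hmin v hτ fun z k hk => by
    rcases lt_or_ge (2 : ℤ) |k| with hk3 | hk3
    · have h9 : (9 : ℝ) ≤ (k : ℝ) ^ 2 := by
        have : (3 : ℝ) ≤ |(k : ℝ)| := by exact_mod_cast hk3
        rw [← sq_abs]
        nlinarith
      have := sum_sq_nonneg fun j => k * v j + ∑ a, (z a : ℝ) * T a j
      nlinarith
    · obtain ⟨hk4, hk5⟩ := abs_le.1 hk3
      have h1 := hv z
      have h2 := hv (-z)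
      have h3 := hv2 z
      have h4 := hv2 (-z)
      interval_cases k
      · have := sum_neg_comb_sq T v 2 z
        norm_num at this h4 ⊢
        linarith
      · have := sum_neg_comb_sq T v 1 z
        norm_num at this h2 ⊢
        linarith
      · exact absurd rfl hk
      · norm_num
        linarith
      · norm_num
        linarith
  have : t ≤ τ := by
    rw [ht, div_le_iff₀ hD]
    calc α ^ (2 * r + 2) ≤ H ^ (r + 1) * (T.det ^ 2 * τ) := key
      _ = _ := by ring
  linarith

end SW

namespace SW

/-! ### Triangular coordinates of a Korkine–Zolotarev basis -/

/-- Gram–Schmidt: orthonormal coordinates in which a given family is triangular. -/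
lemma exists_triangular_coords {n : ℕ} (v : Fin n → Fin n → ℝ) :
    ∃ c : (Fin n → ℝ) →ₗ[ℝ] (Fin n → ℝ), (∀ x y, einner x y = c x ⬝ᵥ c y) ∧
      ∀ i j, i < j → c (v i) j = 0 := by
  let b := InnerProductSpace.gramSchmidtOrthonormalBasis (𝕜 := ℝ)
    (E := EuclideanSpace ℝ (Fin n)) (ι := Fin n) (by simp) fun i => WithLp.toLp 2 (v i)
  refine ⟨(WithLp.linearEquiv 2 ℝ (Fin n → ℝ)).toLinearMap ∘ₗ b.repr.toLinearEquiv.toLinearMap ∘ₗ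
    (WithLp.linearEquiv 2 ℝ (Fin n → ℝ)).symm.toLinearMap, fun x y => ?_, fun i j hij => ?_⟩
  · have h := b.repr.inner_map_map (WithLp.toLp 2 x) (WithLp.toLp 2 y)
    rw [EuclideanSpace.inner_eq_star_dotProduct, EuclideanSpace.inner_eq_star_dotProduct] at h
    rw [dotProduct_comm]
    exact (dotProduct_comm x y).trans h.symm
  · exact InnerProductSpace.gramSchmidtOrthonormalBasis_inv_triangular' _ _ hij

lemma sum_fin_eq_sum_castLE_add {n i : ℕ} (hi : i ≤ n) (f : Fin n → ℝ) :
    ∑ j, f j = ∑ j : Fin i, f (Fin.castLE hi j) +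
      ∑ j ∈ Finset.univ.filter (fun j : Fin n => i ≤ (j : ℕ)), f j := by
  rw [← Finset.sum_filter_add_sum_filter_not Finset.univ (fun j : Fin n => (j : ℕ) < i) f]
  congr 1
  · symm
    refine Finset.sum_bij (fun j _ => Fin.castLE hi j) (by simp) (by simp) ?_ (by simp)
    intro j hj
    exact ⟨⟨j, by simpa using hj⟩, by simp, rfl⟩
  · simp only [not_lt]

/-- Base times height: adjoining `w` to a family spanning the first `i` coordinates. -/
lemma gvol_snoc {n i : ℕ} (hi : i ≤ n) (c : (Fin n → ℝ) →ₗ[ℝ] (Fin n → ℝ))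
    (hc : ∀ x y, einner x y = c x ⬝ᵥ c y) (p : Fin i → Fin n → ℝ)
    (hp : ∀ a (j : Fin n), i ≤ (j : ℕ) → c (p a) j = 0) (w : Fin n → ℝ) :
    gvol (Fin.snoc p w : Fin (i + 1) → Fin n → ℝ) =
      gvol p * √(∑ j ∈ Finset.univ.filter (fun j : Fin n => i ≤ (j : ℕ)), c w j ^ 2) := by
  set s := √(∑ j ∈ Finset.univ.filter (fun j : Fin n => i ≤ (j : ℕ)), c w j ^ 2) with hs
  have hs2 : s * s = ∑ j ∈ Finset.univ.filter (fun j : Fin n => i ≤ (j : ℕ)), c w j ^ 2 :=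
    Real.mul_self_sqrt (Finset.sum_nonneg fun j _ => sq_nonneg _)
  let Y₀ : Matrix (Fin i) (Fin i) ℝ := fun a j => c (p a) (Fin.castLE hi j)
  let q : Fin i → ℝ := fun j => c w (Fin.castLE hi j)
  let Y : Matrix (Fin (i + 1)) (Fin (i + 1)) ℝ :=
    Fin.snoc (α := fun _ => Fin (i + 1) → ℝ) (fun a => Fin.snoc (α := fun _ => ℝ) (Y₀ a) 0)
      (Fin.snoc (α := fun _ => ℝ) q s)
  have hleft : ∀ a (y : Fin n → ℝ),
      einner (p a) y = ∑ j : Fin i, c (p a) (Fin.castLE hi j) * c y (Fin.castLE hi j) := by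
    intro a y
    rw [hc, dotProduct, sum_fin_eq_sum_castLE_add hi, add_eq_left]
    refine Finset.sum_eq_zero fun j hj => ?_
    rw [hp a j (by simpa using hj), zero_mul]
  have h₀ : gvol p = |Y₀.det| := gvol_eq_abs_det p Y₀ fun a b => hleft a (p b)
  have h₁ : gvol (Fin.snoc p w : Fin (i + 1) → Fin n → ℝ) = |Y.det| := by
    refine gvol_eq_abs_det _ Y fun a b => ?_
    have hcomm : ∀ x y : Fin n → ℝ, einner x y = einner y x := fun x y => dotProduct_comm x y
    refine Fin.lastCases ?_ (fun a => ?_) a <;> refine Fin.lastCases ?_ (fun b => ?_) b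
    · simp only [Fin.snoc_last, Y, dotProduct, Fin.sum_univ_castSucc, Fin.snoc_castSucc, hs2]
      rw [hc, dotProduct, sum_fin_eq_sum_castLE_add hi]
      simp [q, sq]
    · simp only [Fin.snoc_last, Y, dotProduct, Fin.sum_univ_castSucc, Fin.snoc_castSucc]
      rw [hcomm, hleft]
      simp [q, Y₀, mul_comm]
    · simp only [Fin.snoc_last, Y, dotProduct, Fin.sum_univ_castSucc, Fin.snoc_castSucc]
      rw [hleft]
      simp [q, Y₀]
    · simp only [Y, dotProduct, Fin.sum_univ_castSucc, Fin.snoc_castSucc, Fin.snoc_last]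
      rw [hleft]
      simp [Y₀]
  have hdet : Y.det = s * Y₀.det := by
    rw [Matrix.det_succ_column _ (Fin.last i), Fin.sum_univ_castSucc]
    have hsub : Y.submatrix (Fin.last i).succAbove (Fin.last i).succAbove = Y₀ := by
      ext a b
      rw [Matrix.submatrix_apply, Fin.succAbove_last]
      simp [Y]
    rw [hsub]
    simp [Y]
  rw [h₁, h₀, hdet, abs_mul, abs_of_nonneg (Real.sqrt_nonneg _), mul_comm]

lemma det_of_forall_lt_eq_zero {r : ℕ} (M : Matrix (Fin r) (Fin r) ℝ)
    (h : ∀ i j, i < j → M i j = 0) : M.det = ∏ i, M i i :=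
  Matrix.det_of_isLowerTriangular M fun i j hij => h i j hij

/-- A Korkine–Zolotarev basis in triangular coordinates: the coefficients are the moduli of the
diagonal entries. -/
lemma HasKZCoeffs.exists_coords {n : ℕ} {L : AddSubgroup (Fin n → ℝ)} {A : ℕ → ℝ}
    (hA : HasKZCoeffs L A) :
    ∃ (v : ℕ → Fin n → ℝ) (c : (Fin n → ℝ) →ₗ[ℝ] (Fin n → ℝ)),
      (∀ x y, einner x y = c x ⬝ᵥ c y) ∧
      (∀ (i : ℕ) (j : Fin n), i < j → c (v i) j = 0) ∧
      (∀ i : Fin n, A i = |c (v i) i| ∧ 0 < A i) ∧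
      (∀ i < n, v i ∈ L) ∧
      ∀ i < n, ∀ w ∈ L, (∃ j : Fin n, i ≤ (j : ℕ) ∧ c w j ≠ 0) →
        A i ^ 2 ≤ ∑ j ∈ Finset.univ.filter (fun j : Fin n => i ≤ (j : ℕ)), c w j ^ 2 := by
  obtain ⟨v, ⟨hli, hL, hKZ⟩, hAv⟩ := hA
  obtain ⟨c, hc, hT⟩ := exists_triangular_coords fun j : Fin n => v j
  have htri : ∀ (i : ℕ) (j : Fin n), i < j → c (v i) j = 0 := fun i j hij =>
    hT ⟨i, hij.trans j.2⟩ j hij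
  have hinj : LinearMap.ker c = ⊥ := by
    refine (Submodule.eq_bot_iff _).2 fun x hx => ?_
    have h : x ⬝ᵥ x = 0 := (hc x x).trans (by rw [LinearMap.mem_ker.1 hx, zero_dotProduct])
    exact dotProduct_self_eq_zero.1 h
  have hdiag : ∀ i : Fin n, c (v i) i ≠ 0 := by
    have hrow : LinearIndependent ℝ (Matrix.of fun i j : Fin n => c (v i) j).row :=
      hli.map' c hinj
    have hdet := ((Matrix.isUnit_iff_isUnit_det _).1
      (Matrix.linearIndependent_rows_iff_isUnit.1 hrow)).ne_zero
    rw [det_of_forall_lt_eq_zero (Matrix.of fun i j : Fin n => c (v i) j)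
      fun i j hij => hT i j hij, Finset.prod_ne_zero_iff] at hdet
    exact fun i => hdet i (Finset.mem_univ i)
  have hsnoc : ∀ i < n, ∀ w, gvol (Fin.snoc (fun j : Fin i => v j) w : Fin (i + 1) → Fin n → ℝ) =
      gvol (fun j : Fin i => v j) *
        √(∑ j ∈ Finset.univ.filter (fun j : Fin n => i ≤ (j : ℕ)), c w j ^ 2) := fun i hi w =>
    gvol_snoc hi.le c hc _ (fun a j hj => htri a j (a.2.trans_le hj)) w
  have hself : ∀ i : Fin n,
      √(∑ j ∈ Finset.univ.filter (fun j : Fin n => (i : ℕ) ≤ (j : ℕ)), c (v i) j ^ 2) =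
        |c (v i) i| := by
    intro i
    rw [Finset.sum_eq_single i, Real.sqrt_sq_eq_abs]
    · intro j hj hne
      have hle : (i : ℕ) ≤ j := by simpa using hj
      rw [htri i j (lt_of_le_of_ne hle fun h => hne (Fin.ext h.symm)), zero_pow two_ne_zero]
    · simp
  have hprefix : ∀ i, (fun j : Fin (i + 1) => v j) =
      (Fin.snoc (fun j : Fin i => v j) (v i) : Fin (i + 1) → Fin n → ℝ) := by
    intro i
    funext j
    refine Fin.lastCases ?_ (fun j => ?_) j <;> simp
  have hpos : ∀ i ≤ n, 0 < gvol (fun j : Fin i => v j) := by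
    intro i
    induction i with
    | zero => intro _; simp [gvol]
    | succ i ih =>
      intro hi
      rw [hprefix, hsnoc i hi, hself ⟨i, hi⟩]
      exact mul_pos (ih (by omega)) (abs_pos.2 (hdiag ⟨i, hi⟩))
  have hAi : ∀ i : Fin n, A i = |c (v i) i| := by
    intro i
    have h := hAv i i.2
    rw [hprefix, hsnoc i i.2, hself, mul_comm] at h
    exact mul_left_cancel₀ (hpos i i.2.le).ne' h
  refine ⟨v, c, hc, htri, fun i => ⟨hAi i, hAi i ▸ abs_pos.2 (hdiag i)⟩, fun i hi => ?_, ?_⟩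
  · rw [hL]
    exact AddSubgroup.subset_closure ⟨i, hi, rfl⟩
  · rintro i hi w hw ⟨j, hij, hj⟩
    have hspan : w ∉ Submodule.span ℝ (v '' Set.Iio i) := by
      intro hmem
      have hle : Submodule.span ℝ (v '' Set.Iio i) ≤
          LinearMap.ker (LinearMap.proj (φ := fun _ : Fin n => ℝ) j ∘ₗ c) := by
        refine Submodule.span_le.2 ?_
        rintro _ ⟨a, ha, rfl⟩
        exact htri a j (lt_of_lt_of_le ha hij)
      exact hj (hle hmem)
    have h := hKZ i hi w hw hspan
    rw [hsnoc i hi, hsnoc i hi, hself ⟨i, hi⟩, ← hAi ⟨i, hi⟩] at h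
    refine (Real.le_sqrt' ?_).1 (le_of_mul_le_mul_left h (hpos i hi.le))
    exact hAi ⟨i, hi⟩ ▸ abs_pos.2 (hdiag ⟨i, hi⟩)

end SW

namespace SW

/-! ### Block decomposition -/

lemma off_add_le_off {k : ℕ} (ns : Fin k → ℕ) {i j : Fin k} (hij : i < j) :
    off ns i + ns i ≤ off ns j := by
  have hins : i ∉ Finset.univ.filter (fun l => l < i) := by simp
  rw [off, off, add_comm, ← Finset.sum_insert hins]
  refine Finset.sum_le_sum_of_subset fun l hl => ?_
  rcases Finset.mem_insert.1 hl with rfl | hl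
  · simpa using hij
  · simpa using (Finset.mem_filter.1 hl).2.trans hij

lemma blockEmb_injective {n k : ℕ} (ns : Fin k → ℕ) (hsum : (∑ j, ns j) = n) :
    Function.Injective fun p : (i : Fin k) × Fin (ns i) => blockEmb ns hsum p.1 p.2 := by
  rintro ⟨i, a⟩ ⟨j, b⟩ h
  have h' : off ns i + (a : ℕ) = off ns j + (b : ℕ) := congrArg Fin.val h
  obtain rfl : i = j := by
    rcases lt_trichotomy i j with hij | hij | hij
    · have := off_add_le_off ns hij
      omega
    · exact hij
    · have := off_add_le_off ns hij
      omega
  obtain rfl : a = b := Fin.ext (by omega)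
  rfl

lemma sum_blockEmb {n k : ℕ} (ns : Fin k → ℕ) (hsum : (∑ j, ns j) = n) (f : Fin n → ℝ) :
    ∑ j, f j = ∑ i, ∑ a, f (blockEmb ns hsum i a) := by
  have hbij := (Fintype.bijective_iff_injective_and_card _).2
    ⟨blockEmb_injective ns hsum, by simp [hsum]⟩
  rw [← Fintype.sum_sigma']
  exact (Fintype.sum_bijective _ hbij _ _ fun _ => rfl).symm

section

variable {n k : ℕ} {L : AddSubgroup (Fin n → ℝ)} {A : ℕ → ℝ} {v : ℕ → Fin n → ℝ}
  {c : (Fin n → ℝ) →ₗ[ℝ] (Fin n → ℝ)}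

/-- Woods' bound on the `i`-th diagonal block of a triangular Korkine–Zolotarev basis. -/
lemma exists_block_dist_sq_lt (htri : ∀ (i : ℕ) (j : Fin n), i < j → c (v i) j = 0)
    (hdiag : ∀ i : Fin n, A i = |c (v i) i| ∧ 0 < A i) (hv : ∀ i < n, v i ∈ L)
    (hKZ : ∀ i < n, ∀ w ∈ L, (∃ j : Fin n, i ≤ (j : ℕ) ∧ c w j ≠ 0) →
      A i ^ 2 ≤ ∑ j ∈ Finset.univ.filter (fun j : Fin n => i ≤ (j : ℕ)), c w j ^ 2)
    (ns : Fin k → ℕ) (hsum : (∑ j, ns j) = n) (i : Fin k) (hi : 0 < ns i)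
    (hcond : (∏ j ∈ Finset.Ico (off ns i) (off ns i + ns i), A j) *
        hermiteConst (ns i + 1) ^ (((ns i : ℝ) + 1) / 2) ≤ 2 * A (off ns i) ^ (ns i))
    (u : Fin (ns i) → ℝ) {ρ : ℝ}
    (hρ : A (off ns i) ^ 2 - A (off ns i) ^ (2 * ns i + 2) /
      ((∏ j ∈ Finset.Ico (off ns i) (off ns i + ns i), A j) ^ 2 *
        hermiteConst (ns i + 1) ^ (ns i + 1)) < ρ) :
    ∃ z : Fin (ns i) → ℤ, ∑ b, (u b + ∑ a : Fin (ns i),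
      (z a : ℝ) * c (v (off ns i + a)) (blockEmb ns hsum i b)) ^ 2 < ρ := by
  let T : Matrix (Fin (ns i)) (Fin (ns i)) ℝ :=
    fun a b => c (v (off ns i + a)) (blockEmb ns hsum i b)
  have hdet : |T.det| = ∏ j ∈ Finset.Ico (off ns i) (off ns i + ns i), A j := by
    rw [det_of_forall_lt_eq_zero T fun a b hab => htri _ _ (by simpa [blockEmb] using hab),
      Finset.abs_prod, Finset.prod_Ico_eq_prod_range, add_tsub_cancel_left, Finset.prod_range]
    exact Finset.prod_congr rfl fun a _ => (hdiag (blockEmb ns hsum i a)).1.symm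
  have hpos : 0 < |T.det| := by
    rw [hdet, Finset.prod_Ico_eq_prod_range, add_tsub_cancel_left, Finset.prod_range]
    exact Finset.prod_pos fun a _ => (hdiag (blockEmb ns hsum i a)).2
  have hT : T.det ≠ 0 := abs_pos.1 hpos
  have hlt : ∀ a : Fin (ns i), off ns i + a < n := fun a => (blockEmb ns hsum i a).2
  have hoff : off ns i < n := hlt ⟨0, hi⟩
  refine exists_dist_sq_lt_of_hermite hi T hT (hdiag ⟨_, hoff⟩).2 (fun z hz => ?_)
    (hdet ▸ hcond) u (hdet ▸ hρ)
  set w : Fin n → ℝ := ∑ a : Fin (ns i), z a • v (off ns i + a) with hw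
  have hwL : w ∈ L := L.sum_mem fun a _ => L.zsmul_mem (hv _ (hlt a)) _
  have hcw : ∀ j, c w j = ∑ a : Fin (ns i), (z a : ℝ) * c (v (off ns i + a)) j := fun j => by
    simp only [hw, map_sum, Finset.sum_apply, map_zsmul, Pi.smul_apply]
    simp only [zsmul_eq_mul]
  have hne : ∃ b, c w (blockEmb ns hsum i b) ≠ 0 := by
    by_contra! h
    have h0 := Matrix.eq_zero_of_vecMul_eq_zero hT (v := fun a => (z a : ℝ))
      (funext fun b => (hcw _).symm.trans (h b))
    exact hz (funext fun a => Int.cast_eq_zero.1 (congrFun h0 a))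
  obtain ⟨b, hb⟩ := hne
  refine (hKZ _ hoff w hwL ⟨_, Nat.le_add_right _ _, hb⟩).trans_eq ?_
  rw [Finset.sum_filter, sum_blockEmb ns hsum, Finset.sum_eq_single i]
  · refine Finset.sum_congr rfl fun b _ => ?_
    rw [if_pos (show off ns i ≤ (blockEmb ns hsum i b : ℕ) from Nat.le_add_right _ _), hcw]
  · intro i' _ hne
    refine Finset.sum_eq_zero fun b' _ => ?_
    rcases lt_or_gt_of_ne hne with h | h
    · have := off_add_le_off ns h
      rw [if_neg]
      simp only [blockEmb]
      omega
    · have := off_add_le_off ns h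
      have h0 : c w (blockEmb ns hsum i' b') = 0 := by
        rw [hcw]
        refine Finset.sum_eq_zero fun a _ => ?_
        rw [htri _ _ (by simp only [blockEmb]; omega), mul_zero]
      simp [h0]
  · simp

/-- Approximating a point by a lattice vector block by block, starting from the last block. -/
lemma exists_forall_block_dist_sq_lt (htri : ∀ (i : ℕ) (j : Fin n), i < j → c (v i) j = 0)
    (hv : ∀ i < n, v i ∈ L) (ns : Fin k → ℕ) (hsum : (∑ j, ns j) = n) (ρ : Fin k → ℝ)
    (hblock : ∀ (i : Fin k) (u : Fin (ns i) → ℝ), ∃ z : Fin (ns i) → ℤ,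
      ∑ b, (u b + ∑ a : Fin (ns i),
        (z a : ℝ) * c (v (off ns i + a)) (blockEmb ns hsum i b)) ^ 2 < ρ i)
    (u : Fin n → ℝ) :
    ∃ w ∈ L, ∀ i, ∑ b, c (u - w) (blockEmb ns hsum i b) ^ 2 < ρ i := by
  suffices h : ∀ t : ℕ, ∃ w ∈ L, ∀ i : Fin k, k ≤ i + t →
      ∑ b, c (u - w) (blockEmb ns hsum i b) ^ 2 < ρ i by
    obtain ⟨w, hw, h⟩ := h k
    exact ⟨w, hw, fun i => h i (Nat.le_add_left _ _)⟩
  intro t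
  induction t with
  | zero => exact ⟨0, L.zero_mem, fun i hi => absurd i.2 (by omega)⟩
  | succ t ih =>
    obtain ⟨w, hw, h⟩ := ih
    rcases le_or_gt k t with htk | htk
    · exact ⟨w, hw, fun i _ => h i (by omega)⟩
    let i₀ : Fin k := ⟨k - t - 1, by omega⟩
    obtain ⟨z, hz⟩ := hblock i₀ fun b => c (u - w) (blockEmb ns hsum i₀ b)
    have hcw : ∀ j, c (u - (w - ∑ a : Fin (ns i₀), z a • v (off ns i₀ + a))) j =
        c (u - w) j + ∑ a : Fin (ns i₀), (z a : ℝ) * c (v (off ns i₀ + a)) j := fun j => by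
      rw [← sub_add, map_add]
      simp only [Pi.add_apply, map_sum, Finset.sum_apply, map_zsmul, Pi.smul_apply]
      simp only [zsmul_eq_mul]
    refine ⟨w - ∑ a : Fin (ns i₀), z a • v (off ns i₀ + a), L.sub_mem hw
      (L.sum_mem fun a _ => L.zsmul_mem (hv _ (blockEmb ns hsum i₀ a).2) _), fun i hi => ?_⟩
    simp only [hcw]
    rcases eq_or_ne i i₀ with rfl | hne
    · exact hz
    · have hne' : (i : ℕ) ≠ k - t - 1 := fun h => hne (Fin.ext h)
      have hlt : i₀ < i := Fin.lt_def.2 (show k - t - 1 < (i : ℕ) by omega)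
      have hoff := off_add_le_off ns hlt
      refine (Finset.sum_congr rfl fun b _ => ?_).trans_lt (h i (by omega))
      rw [Finset.sum_eq_zero fun a _ => ?_, add_zero]
      rw [htri _ _ (by simp only [blockEmb]; omega), mul_zero]

end

lemma covrad_sq_le {n : ℕ} {L : AddSubgroup (Fin n → ℝ)} {X : ℝ}
    (h : ∀ u, ∃ w ∈ L, enorm (u - w) ^ 2 ≤ X) : covrad L ^ 2 ≤ X := by
  have hX : 0 ≤ X := by
    obtain ⟨w, -, hw⟩ := h 0
    exact (sq_nonneg _).trans hw
  have hbdd : ∀ u, BddBelow (Set.range fun w : L => enorm (u - (w : Fin n → ℝ))) := fun u =>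
    ⟨0, by rintro _ ⟨w, rfl⟩; exact enorm_nonneg _⟩
  have h0 : 0 ≤ covrad L := Real.iSup_nonneg fun u => Real.iInf_nonneg fun w => enorm_nonneg _
  have hle : covrad L ≤ √X := ciSup_le fun u => by
    obtain ⟨w, hw, hwX⟩ := h u
    exact (ciInf_le (hbdd u) ⟨w, hw⟩).trans (Real.le_sqrt_of_sq_le hwX)
  exact (Real.le_sqrt h0 hX).1 hle

end SW

/-- **Proposition 5.4.** (Woods' method.) If `A 0, …, A (n-1)` are diagonal KZ coefficients of
`x ∈ ℒ_n`, `n = n₁ + ⋯ + n_k`, `d_i = ∏_{j=m_{i-1}+1}^{m_i} A_j`, and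
`2 A_{m_{i-1}+1}^{n_i} ≥ d_i γ_{n_i+1}^{(n_i+1)/2}` for each `i`, then
`covrad²(x) ≤ ∑ᵢ (A_{m_{i-1}+1}² - A_{m_{i-1}+1}^{2n_i+2} / (d_i² γ_{n_i+1}^{n_i+1}))`. -/
theorem SW.covrad_bound_from_KZ (n k : ℕ) (hn : 0 < n) (hk : 0 < k)
    (L : AddSubgroup (Fin n → ℝ)) (hL : SW.IsUnimodularLattice L)
    (A : ℕ → ℝ) (hA : SW.HasKZCoeffs L A)
    (ns : Fin k → ℕ) (hns : ∀ i, 0 < ns i) (hsum : (∑ j, ns j) = n)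
    (hcond : ∀ i : Fin k,
      (∏ j ∈ Finset.Ico (SW.off ns i) (SW.off ns i + ns i), A j) *
          SW.hermiteConst (ns i + 1) ^ (((ns i : ℝ) + 1) / 2) ≤
        2 * A (SW.off ns i) ^ (ns i)) :
    SW.covrad L ^ 2 ≤ ∑ i : Fin k,
      (A (SW.off ns i) ^ 2 - A (SW.off ns i) ^ (2 * ns i + 2) /
        ((∏ j ∈ Finset.Ico (SW.off ns i) (SW.off ns i + ns i), A j) ^ 2 *
          SW.hermiteConst (ns i + 1) ^ (ns i + 1))) := by
  obtain ⟨v, c, hc, htri, hdiag, hv, hKZ⟩ := hA.exists_coords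
  refine le_of_forall_pos_le_add fun ε hε => ?_
  have hk' : (0 : ℝ) < k := by exact_mod_cast hk
  refine SW.covrad_sq_le fun u => ?_
  obtain ⟨w, hw, hdist⟩ := SW.exists_forall_block_dist_sq_lt htri hv ns hsum
    (fun i => _ + ε / k) (fun i u => SW.exists_block_dist_sq_lt htri hdiag hv hKZ ns hsum i
      (hns i) (hcond i) u (lt_add_of_pos_right _ (div_pos hε hk'))) u
  refine ⟨w, hw, ?_⟩
  have hnorm : SW.enorm (u - w) ^ 2 = ∑ j, c (u - w) j ^ 2 := by
    rw [SW.enorm_sq]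
    simpa [SW.einner, dotProduct, sq] using hc (u - w) (u - w)
  rw [hnorm, SW.sum_blockEmb ns hsum]
  refine (Finset.sum_le_sum fun i _ => (hdist i).le).trans_eq ?_
  rw [Finset.sum_add_distrib, Finset.sum_const, Finset.card_univ, Fintype.card_fin, nsmul_eq_mul,
    mul_div_cancel₀ _ hk'.ne']
end
end
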